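/- arXiv:1304.4267 — 2 statements merged into one kernel-verified Lean document; each statement's English description precedes it below -/
import Mathlib

section
/- For every Positive Greatest Fixed Point Logic sentence θ there exists an Inclusion Logic sentence φ over the same signature such that for all structures M: M ⊨ θ if and only if M ⊨ φ. -/
open FirstOrder Language Set

namespace TeamSem

/-- The set of variables occurring in a term. -/
def tvars {L : Language} : L.Term ℕ → Set ℕ
  | Term.var v => {v}
  | Term.func _ ts => ⋃ i, tvars (ts i)

/-- Formulas of Inclusion Logic FO(⊆) in negation normal form, over the signature `L`,
with variables from `ℕ`. -/
inductive IncForm (L : Language) where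
  | rel {n : ℕ} (R : L.Relations n) (ts : Fin n → L.Term ℕ)
  | nrel {n : ℕ} (R : L.Relations n) (ts : Fin n → L.Term ℕ)
  | eq (t u : L.Term ℕ)
  | neq (t u : L.Term ℕ)
  | incl {k : ℕ} (ts us : Fin k → L.Term ℕ)
  | and (φ ψ : IncForm L)
  | or (φ ψ : IncForm L)
  | ex (v : ℕ) (φ : IncForm L)
  | all (v : ℕ) (φ : IncForm L)

variable {L : Language}

/-- The supplemented team `X[H/v]`. -/
def suppTeam {M : Type*} (X : Set (ℕ → M)) (H : (ℕ → M) → Set M) (v : ℕ) : Set (ℕ → M) :=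
  {t | ∃ s ∈ X, ∃ m ∈ H s, t = Function.update s v m}

/-- The duplicated team `X[M/v]`. -/
def dupTeam (M : Type*) (X : Set (ℕ → M)) (v : ℕ) : Set (ℕ → M) :=
  {t | ∃ s ∈ X, ∃ m : M, t = Function.update s v m}

/-- Lax team semantics for Inclusion Logic: `teamSat M φ X` says `M ⊨_X φ`. -/
def teamSat (M : Type*) [L.Structure M] : IncForm L → Set (ℕ → M) → Prop
  | .rel R ts, X => ∀ s ∈ X, Structure.RelMap R fun i => (ts i).realize s
  | .nrel R ts, X => ∀ s ∈ X, ¬ Structure.RelMap R fun i => (ts i).realize s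
  | .eq t u, X => ∀ s ∈ X, t.realize s = u.realize s
  | .neq t u, X => ∀ s ∈ X, t.realize s ≠ u.realize s
  | .incl ts us, X => ∀ s ∈ X, ∃ s' ∈ X, ∀ i, (ts i).realize s = (us i).realize s'
  | .and φ ψ, X => teamSat M φ X ∧ teamSat M ψ X
  | .or φ ψ, X => ∃ Y Z, X = Y ∪ Z ∧ teamSat M φ Y ∧ teamSat M ψ Z
  | .ex v φ, X => ∃ H : (ℕ → M) → Set M, (∀ s ∈ X, (H s).Nonempty) ∧
      teamSat M φ (suppTeam X H v)
  | .all v φ, X => teamSat M φ (dupTeam M X v)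

/-- Free variables of an Inclusion Logic formula. -/
def fvInc : IncForm L → Set ℕ
  | .rel _ ts => ⋃ i, tvars (ts i)
  | .nrel _ ts => ⋃ i, tvars (ts i)
  | .eq t u => tvars t ∪ tvars u
  | .neq t u => tvars t ∪ tvars u
  | .incl ts us => (⋃ i, tvars (ts i)) ∪ ⋃ i, tvars (us i)
  | .and φ ψ => fvInc φ ∪ fvInc ψ
  | .or φ ψ => fvInc φ ∪ fvInc ψ
  | .ex v φ => fvInc φ \ {v}
  | .all v φ => fvInc φ \ {v}

/-- Truth of an FO(⊆) sentence in a model: satisfaction by the team consisting of the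
empty assignment (encoded, with total assignments, as the singleton team `{s}` for
every `s`; for sentences all these coincide). -/
def incTrue (M : Type*) [L.Structure M] (φ : IncForm L) : Prop :=
  ∀ s : ℕ → M, teamSat M φ {s}

/-- The relation `X(x̄)` of values of a team, for `x̄ = (x_0, …, x_{n-1})` where we use
the variables `0, …, n-1` for `x₁, …, xₙ`. -/
def teamRel (n : ℕ) {M : Type*} (X : Set (ℕ → M)) : Set (Fin n → M) :=
  {a | ∃ s ∈ X, a = fun j : Fin n => s (j : ℕ)}

end TeamSem

namespace TeamSem

/-- Interpretations of second-order relation variables: relation variable number `i`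
of arity `k` is interpreted as `I k i`. -/
def RelInterp (M : Type*) : Type _ := (k : ℕ) → ℕ → Set (Fin k → M)

/-- The trivial interpretation (all relation variables empty). -/
def botI (M : Type*) : RelInterp M := fun _ _ => ∅

/-- Update the interpretation of relation variable `i` of arity `n` to `Q`. -/
def updI {M : Type*} (I : RelInterp M) (n i : ℕ) (Q : Set (Fin n → M)) : RelInterp M :=
  fun k j => {a | if h : k = n ∧ j = i then (fun m => a (Fin.cast h.1.symm m)) ∈ Q else a ∈ I k j}

/-- Simultaneous update of an assignment on the variables `xs` by the tuple `a`. -/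
noncomputable def updVec {M : Type*} (s : ℕ → M) {n : ℕ} (xs : Fin n → ℕ)
    (a : Fin n → M) : ℕ → M :=
  fun v => if h : ∃ j, xs j = v then a h.choose else s v

/-- Formulas of Positive Greatest Fixed Point Logic (PGFP) in negation normal form:
second-order relation variables (`rvar i`, of arity `n`) and the `gfp` operator can occur
only positively (there are no negated `rvar`/`gfp` constructors). -/
inductive GFPForm (L : Language) where
  | rel {n : ℕ} (R : L.Relations n) (ts : Fin n → L.Term ℕ)
  | nrel {n : ℕ} (R : L.Relations n) (ts : Fin n → L.Term ℕ)
  | eq (t u : L.Term ℕ)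
  | neq (t u : L.Term ℕ)
  | rvar (i : ℕ) {n : ℕ} (ts : Fin n → L.Term ℕ)
  | and (φ ψ : GFPForm L)
  | or (φ ψ : GFPForm L)
  | ex (v : ℕ) (φ : GFPForm L)
  | all (v : ℕ) (φ : GFPForm L)
  | gfp (i n : ℕ) (xs : Fin n → ℕ) (φ : GFPForm L) (ts : Fin n → L.Term ℕ)

variable {L : Language}

/-- Tarski semantics for PGFP.  The clause for `gfp i n xs φ ts` uses the Knaster–Tarski
characterization: the greatest fixed point of the monotone operator
`Γ(Q) = {ā | (M, Q/i) ⊨ φ(ā)}` equals `⋃ {Q | Q ⊆ Γ(Q)}`. -/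
def gsat (M : Type*) [L.Structure M] : GFPForm L → RelInterp M → (ℕ → M) → Prop
  | .rel R ts, _, s => Structure.RelMap R fun i => (ts i).realize s
  | .nrel R ts, _, s => ¬ Structure.RelMap R fun i => (ts i).realize s
  | .eq t u, _, s => t.realize s = u.realize s
  | .neq t u, _, s => t.realize s ≠ u.realize s
  | .rvar i ts, I, s => (fun j => (ts j).realize s) ∈ I _ i
  | .and φ ψ, I, s => gsat M φ I s ∧ gsat M ψ I s
  | .or φ ψ, I, s => gsat M φ I s ∨ gsat M ψ I s
  | .ex v φ, I, s => ∃ m : M, gsat M φ I (Function.update s v m)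
  | .all v φ, I, s => ∀ m : M, gsat M φ I (Function.update s v m)
  | .gfp i n xs φ ts, I, s =>
      (fun j => (ts j).realize s) ∈
        ⋃₀ {Q : Set (Fin n → M) | Q ⊆ {a | gsat M φ (updI I n i Q) (updVec s xs a)}}

/-- Free first-order variables of a PGFP formula. -/
def fvG : GFPForm L → Set ℕ
  | .rel _ ts => ⋃ i, tvars (ts i)
  | .nrel _ ts => ⋃ i, tvars (ts i)
  | .eq t u => tvars t ∪ tvars u
  | .neq t u => tvars t ∪ tvars u
  | .rvar _ ts => ⋃ i, tvars (ts i)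
  | .and φ ψ => fvG φ ∪ fvG ψ
  | .or φ ψ => fvG φ ∪ fvG ψ
  | .ex v φ => fvG φ \ {v}
  | .all v φ => fvG φ \ {v}
  | .gfp _ _ xs φ ts => (⋃ i, tvars (ts i)) ∪ (fvG φ \ Set.range fun j => xs j)

/-- All first-order variables (free or bound) occurring in a PGFP formula. -/
def avG : GFPForm L → Set ℕ
  | .rel _ ts => ⋃ i, tvars (ts i)
  | .nrel _ ts => ⋃ i, tvars (ts i)
  | .eq t u => tvars t ∪ tvars u
  | .neq t u => tvars t ∪ tvars u
  | .rvar _ ts => ⋃ i, tvars (ts i)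
  | .and φ ψ => avG φ ∪ avG ψ
  | .or φ ψ => avG φ ∪ avG ψ
  | .ex v φ => {v} ∪ avG φ
  | .all v φ => {v} ∪ avG φ
  | .gfp _ _ xs φ ts => (⋃ i, tvars (ts i)) ∪ (Set.range fun j => xs j) ∪ avG φ

/-- Free relation variables of a PGFP formula, together with their arities. -/
def rvG : GFPForm L → Set (ℕ × ℕ)
  | @GFPForm.rvar _ i n _ => {(i, n)}
  | .and φ ψ => rvG φ ∪ rvG ψ
  | .or φ ψ => rvG φ ∪ rvG ψ
  | .ex _ φ => rvG φ
  | .all _ φ => rvG φ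
  | .gfp i n _ φ _ => rvG φ \ {(i, n)}
  | _ => ∅

/-- PGFP formulas containing no `gfp` operator, i.e. first-order formulas
(possibly mentioning relation variables positively). -/
def NoGfp : GFPForm L → Prop
  | .and φ ψ => NoGfp φ ∧ NoGfp ψ
  | .or φ ψ => NoGfp φ ∧ NoGfp ψ
  | .ex _ φ => NoGfp φ
  | .all _ φ => NoGfp φ
  | .gfp .. => False
  | _ => True

end TeamSem

namespace TeamSem

variable {L : Language} {M : Type*}

/-! ### Blocks of existential quantifiers -/

/-- The assignments `s` and `t` agree on all variables outside `[a, a + k)`. -/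
def AgreeOff (a k : ℕ) (s t : ℕ → M) : Prop :=
  ∀ v, (v < a ∨ a + k ≤ v) → t v = s v

/-- The team `Y` arises from `X` by choosing new values for the variables in `[a, a + k)`. -/
def Extends (a k : ℕ) (X Y : Set (ℕ → M)) : Prop :=
  (∀ t ∈ Y, ∃ s ∈ X, AgreeOff a k s t) ∧ ∀ s ∈ X, ∃ t ∈ Y, AgreeOff a k s t

/-- Existential quantification over the variables in `[a, a + k)`. -/
def exBlock : ℕ → ℕ → IncForm L → IncForm L
  | _, 0, φ => φ
  | a, k + 1, φ => .ex a (exBlock (a + 1) k φ)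

/-- The assignment `s` with the values on `[a, a + k)` replaced by `w`. -/
def override (s : ℕ → M) (a k : ℕ) (w : ℕ → M) : ℕ → M :=
  fun v => if a ≤ v ∧ v < a + k then w (v - a) else s v

theorem agreeOff_override (s : ℕ → M) (a k : ℕ) (w : ℕ → M) :
    AgreeOff a k s (override s a k w) := by
  intro v hv
  have : ¬ (a ≤ v ∧ v < a + k) := by omega
  simp [override, this]

theorem override_add (s : ℕ → M) (a k : ℕ) (w : ℕ → M) {j : ℕ} (hj : j < k) :
    override s a k w (a + j) = w j := by
  simp [override, hj]

theorem agreeOff_update (s : ℕ → M) (d : ℕ) (m : M) :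
    AgreeOff d 1 s (Function.update s d m) := by
  intro v hv
  exact Function.update_of_ne (by omega) _ _

theorem extends_setOf {a k : ℕ} {X : Set (ℕ → M)} {P : (ℕ → M) → (ℕ → M) → Prop}
    (h : ∀ s ∈ X, ∃ t, AgreeOff a k s t ∧ P s t) :
    Extends a k X {t | ∃ s ∈ X, AgreeOff a k s t ∧ P s t} := by
  refine ⟨fun t ⟨s, hs, ha, _⟩ => ⟨s, hs, ha⟩, fun s hs => ?_⟩
  obtain ⟨t, ha, hp⟩ := h s hs
  exact ⟨t, ⟨s, hs, ha, hp⟩, ha⟩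

theorem extends_dupTeam (X : Set (ℕ → M)) (d : ℕ) : Extends d 1 X (dupTeam M X d) := by
  refine ⟨?_, fun s hs => ⟨_, ⟨s, hs, s d, rfl⟩, agreeOff_update _ _ _⟩⟩
  rintro _ ⟨s, hs, m, rfl⟩
  exact ⟨s, hs, agreeOff_update _ _ _⟩

theorem teamSat_exBlock [L.Structure M] (φ : IncForm L) (k a : ℕ) (X : Set (ℕ → M)) :
    teamSat M (exBlock a k φ) X ↔ ∃ Y, Extends a k X Y ∧ teamSat M φ Y := by
  induction k generalizing a X with
  | zero =>
    have key : ∀ s t : ℕ → M, AgreeOff a 0 s t → t = s :=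
      fun s t h => funext fun v => h v (by omega)
    constructor
    · intro h
      exact ⟨X, ⟨fun t ht => ⟨t, ht, fun _ _ => rfl⟩, fun t ht => ⟨t, ht, fun _ _ => rfl⟩⟩, h⟩
    · rintro ⟨Y, ⟨h1, h2⟩, h⟩
      have : X = Y := by
        ext s
        constructor
        · intro hs
          obtain ⟨t, ht, hst⟩ := h2 s hs
          rwa [← key _ _ hst]
        · intro ht
          obtain ⟨t, hs, hst⟩ := h1 s ht
          rwa [key _ _ hst]
      rw [this]
      exact h
  | succ k ih =>
    simp only [exBlock, teamSat, ih]
    constructor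
    · rintro ⟨H, hH, Y, ⟨h1, h2⟩, hY⟩
      refine ⟨Y, ⟨fun t ht => ?_, fun s hs => ?_⟩, hY⟩
      · obtain ⟨_, ⟨s, hs, m, _, rfl⟩, h⟩ := h1 t ht
        refine ⟨s, hs, fun v hv => ?_⟩
        rw [h v (by omega), Function.update_of_ne (by omega)]
      · obtain ⟨m, hm⟩ := hH s hs
        obtain ⟨t, ht, h⟩ := h2 _ ⟨s, hs, m, hm, rfl⟩
        refine ⟨t, ht, fun v hv => ?_⟩
        rw [h v (by omega), Function.update_of_ne (by omega)]
    · rintro ⟨Y, ⟨h1, h2⟩, hY⟩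
      have key : ∀ s t : ℕ → M, AgreeOff a (k + 1) s t →
          AgreeOff (a + 1) k (Function.update s a (t a)) t := by
        intro s t h v hv
        by_cases hva : v = a
        · subst hva; simp
        · rw [Function.update_of_ne hva, h v (by omega)]
      refine ⟨fun s => {m | ∃ t ∈ Y, AgreeOff a (k + 1) s t ∧ t a = m}, fun s hs => ?_,
        Y, ⟨fun t ht => ?_, ?_⟩, hY⟩
      · obtain ⟨t, ht, h⟩ := h2 s hs
        exact ⟨t a, t, ht, h, rfl⟩
      · obtain ⟨s, hs, h⟩ := h1 t ht
        exact ⟨_, ⟨s, hs, t a, ⟨t, ht, h, rfl⟩, rfl⟩, key s t h⟩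
      · rintro _ ⟨s, hs, _, ⟨t, ht, h, rfl⟩, rfl⟩
        exact ⟨t, ht, key s t h⟩

/-! ### Elementary facts about inclusion logic -/

theorem teamSat_empty [L.Structure M] (φ : IncForm L) : teamSat M φ ∅ := by
  induction φ with
  | and φ ψ h1 h2 => exact ⟨h1, h2⟩
  | or φ ψ h1 h2 => exact ⟨∅, ∅, by simp, h1, h2⟩
  | ex v φ h => exact ⟨fun _ => Set.univ, by simp, by simpa [suppTeam] using h⟩
  | all v φ h => simpa [teamSat, dupTeam] using h
  | _ => simp [teamSat]

theorem finite_tvars (t : L.Term ℕ) : (tvars t).Finite := by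
  induction t with
  | var v => exact Set.finite_singleton v
  | func f ts ih => exact Set.finite_iUnion ih

theorem finite_fvInc (φ : IncForm L) : (fvInc φ).Finite := by
  induction φ with
  | rel R ts => exact Set.finite_iUnion fun i => finite_tvars _
  | nrel R ts => exact Set.finite_iUnion fun i => finite_tvars _
  | eq t u => exact (finite_tvars t).union (finite_tvars u)
  | neq t u => exact (finite_tvars t).union (finite_tvars u)
  | incl ts us =>
    exact (Set.finite_iUnion fun i => finite_tvars _).union
      (Set.finite_iUnion fun i => finite_tvars _)
  | and φ ψ h1 h2 => exact h1.union h2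
  | or φ ψ h1 h2 => exact h1.union h2
  | ex v φ h => exact h.sdiff
  | all v φ h => exact h.sdiff

theorem fvInc_exBlock (φ : IncForm L) (k a : ℕ) :
    fvInc (exBlock a k φ) ⊆ fvInc φ \ {v | a ≤ v ∧ v < a + k} := by
  induction k generalizing a with
  | zero =>
    intro v hv
    exact ⟨hv, fun h => by have h1 := h.1; have h2 := h.2; omega⟩
  | succ k ih =>
    rintro v ⟨hv, hva⟩
    obtain ⟨h1, h2⟩ := ih (a + 1) hv
    refine ⟨h1, fun h => h2 ?_⟩
    have h3 := h.1
    have h4 := h.2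
    have h5 : v ≠ a := hva
    exact ⟨by omega, by omega⟩

/-- The formula `φ` restricted to the assignments that give `g` and `g + 1` the same value. -/
def guarded (g : ℕ) (φ : IncForm L) : IncForm L :=
  .or (.neq (.var g) (.var (g + 1))) φ

theorem teamSat_guarded [L.Structure M] {g : ℕ} {φ : IncForm L} {P : (ℕ → M) → Prop}
    (hφ : ∀ X, teamSat M φ X ↔ ∀ s ∈ X, P s) (X : Set (ℕ → M)) :
    teamSat M (guarded g φ) X ↔ ∀ s ∈ X, s g = s (g + 1) → P s := by
  simp only [guarded, teamSat, hφ, Term.realize_var]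
  constructor
  · rintro ⟨Y, Z, rfl, hY, hZ⟩ s (hs | hs) h
    · exact absurd h (hY s hs)
    · exact hZ s hs
  · intro h
    refine ⟨{s ∈ X | s g ≠ s (g + 1)}, {s ∈ X | s g = s (g + 1)}, ?_, fun s hs => hs.2,
      fun s hs => h s hs.1 hs.2⟩
    ext s
    simp only [Set.mem_union, Set.mem_ofPred_eq]
    tauto

/-- The conjunction of a list of equations. -/
def eqs : List (L.Term ℕ × L.Term ℕ) → IncForm L
  | [] => .eq (.var 0) (.var 0)
  | p :: l => .and (.eq p.1 p.2) (eqs l)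

theorem teamSat_eqs [L.Structure M] (l : List (L.Term ℕ × L.Term ℕ)) (X : Set (ℕ → M)) :
    teamSat M (eqs l) X ↔ ∀ s ∈ X, ∀ p ∈ l, p.1.realize s = p.2.realize s := by
  induction l with
  | nil => simp [eqs, teamSat]
  | cons p l ih =>
    simp only [eqs, teamSat, ih, List.forall_mem_cons]
    exact ⟨fun h s hs => ⟨h.1 s hs, h.2 s hs⟩, fun h => ⟨fun s hs => (h s hs).1,
      fun s hs => (h s hs).2⟩⟩

/-! ### Elementary facts about greatest fixed point logic -/

theorem realize_congr [L.Structure M] (t : L.Term ℕ) {s s' : ℕ → M}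
    (h : ∀ v ∈ tvars t, s v = s' v) : t.realize s = t.realize s' := by
  induction t with
  | var v => exact h v rfl
  | func f ts ih =>
    simp only [Term.realize_func]
    congr 1
    funext i
    exact ih i fun v hv => h v (Set.mem_iUnion.2 ⟨i, hv⟩)

theorem realize_tuple_congr [L.Structure M] {n : ℕ} (ts : Fin n → L.Term ℕ) {s s' : ℕ → M}
    (h : ∀ v ∈ ⋃ i, tvars (ts i), s v = s' v) :
    (fun i => (ts i).realize s) = fun i => (ts i).realize s' :=
  funext fun i => realize_congr _ fun v hv => h v (Set.mem_iUnion.2 ⟨i, hv⟩)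

theorem update_agree {A : Set ℕ} {s s' : ℕ → M} {v : ℕ} (h : ∀ u ∈ A \ {v}, s u = s' u) (m : M) :
    ∀ u ∈ A, Function.update s v m u = Function.update s' v m u := by
  intro u hu
  by_cases huv : u = v
  · subst huv; simp
  · simp [huv, h u ⟨hu, huv⟩]

theorem gsat_congr [L.Structure M] (φ : GFPForm L) (I : RelInterp M) {s s' : ℕ → M}
    (h : ∀ v ∈ fvG φ, s v = s' v) : gsat M φ I s ↔ gsat M φ I s' := by
  induction φ generalizing I s s' with
  | rel R ts => simp only [gsat]; rw [realize_tuple_congr ts h]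
  | nrel R ts => simp only [gsat]; rw [realize_tuple_congr ts h]
  | eq t u =>
    simp only [gsat]
    rw [realize_congr t fun v hv => h v (Or.inl hv), realize_congr u fun v hv => h v (Or.inr hv)]
  | neq t u =>
    simp only [gsat]
    rw [realize_congr t fun v hv => h v (Or.inl hv), realize_congr u fun v hv => h v (Or.inr hv)]
  | rvar i ts => simp only [gsat]; rw [realize_tuple_congr ts h]
  | and φ ψ h1 h2 =>
    exact and_congr (h1 I fun v hv => h v (Or.inl hv)) (h2 I fun v hv => h v (Or.inr hv))
  | or φ ψ h1 h2 =>
    exact or_congr (h1 I fun v hv => h v (Or.inl hv)) (h2 I fun v hv => h v (Or.inr hv))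
  | ex v φ ih => exact exists_congr fun m => ih I (update_agree h m)
  | all v φ ih => exact forall_congr' fun m => ih I (update_agree h m)
  | gfp i n xs φ ts ih =>
    have key : ∀ (Q : Set (Fin n → M)) a, gsat M φ (updI I n i Q) (updVec s xs a) ↔
        gsat M φ (updI I n i Q) (updVec s' xs a) := by
      intro Q a
      refine ih _ fun v hv => ?_
      unfold updVec
      split_ifs with hx
      · rfl
      · exact h v (Or.inr ⟨hv, hx⟩)
    simp only [gsat, key]
    rw [realize_tuple_congr ts fun v hv => h v (Or.inl hv)]

theorem updI_mono {I J : RelInterp M} (h : ∀ k i, I k i ⊆ J k i) (n i : ℕ)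
    {Q Q' : Set (Fin n → M)} (hQ : Q ⊆ Q') : ∀ k j, updI I n i Q k j ⊆ updI J n i Q' k j := by
  intro k j a
  simp only [updI, Set.mem_ofPred_eq]
  split_ifs with hk
  · exact fun ha => hQ ha
  · exact fun ha => h k j ha

theorem gsat_mono [L.Structure M] (φ : GFPForm L) {I J : RelInterp M}
    (h : ∀ k i, I k i ⊆ J k i) {s : ℕ → M} (hs : gsat M φ I s) : gsat M φ J s := by
  induction φ generalizing I J s with
  | rel R ts => exact hs
  | nrel R ts => exact hs
  | eq t u => exact hs
  | neq t u => exact hs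
  | rvar i ts => exact h _ _ hs
  | and φ ψ h1 h2 => exact ⟨h1 h hs.1, h2 h hs.2⟩
  | or φ ψ h1 h2 => exact hs.imp (h1 h) (h2 h)
  | ex v φ ih => exact hs.imp fun m => ih h
  | all v φ ih => exact fun m => ih h (hs m)
  | gfp i n xs φ ts ih =>
    obtain ⟨Q, hQ, hm⟩ := hs
    exact ⟨Q, fun a ha => ih (updI_mono h n i subset_rfl) (hQ ha), hm⟩

/-! ### One-element structures -/

open Classical in
/-- A quantifier-free inclusion logic formula equivalent to `φ` on one-element structures, where
`B n i` says that the relation variable `i` of arity `n` is nonempty. -/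
noncomputable def pointForm : GFPForm L → (ℕ → ℕ → Prop) → IncForm L
  | .rel R ts, _ => .rel R ts
  | .nrel R ts, _ => .nrel R ts
  | .eq t u, _ => .eq t u
  | .neq t u, _ => .neq t u
  | @GFPForm.rvar _ i n _, B => if B n i then .eq (.var 0) (.var 0) else .neq (.var 0) (.var 0)
  | .and φ ψ, B => .and (pointForm φ B) (pointForm ψ B)
  | .or φ ψ, B => .or (pointForm φ B) (pointForm ψ B)
  | .ex _ φ, B => pointForm φ B
  | .all _ φ, B => pointForm φ B
  | .gfp i n _ φ _, B => pointForm φ fun k j => (k = n ∧ j = i) ∨ B k j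

theorem teamSat_pointForm [L.Structure M] [Subsingleton M] (φ : GFPForm L) (B : ℕ → ℕ → Prop)
    (X : Set (ℕ → M)) :
    teamSat M (pointForm φ B) X ↔ ∀ s ∈ X, gsat M φ (fun k i => {_a | B k i}) s := by
  induction φ generalizing B X with
  | rel R ts => rfl
  | nrel R ts => rfl
  | eq t u => rfl
  | neq t u => rfl
  | rvar i ts =>
    simp only [pointForm, gsat, Set.mem_ofPred_eq]
    split_ifs with h <;> simp [teamSat, h]
  | and φ ψ h1 h2 => simp only [pointForm, teamSat, h1, h2, gsat, forall_and]
  | or φ ψ h1 h2 =>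
    simp only [pointForm, teamSat, h1, h2, gsat]
    constructor
    · rintro ⟨Y, Z, rfl, hY, hZ⟩ s (hs | hs)
      · exact Or.inl (hY s hs)
      · exact Or.inr (hZ s hs)
    · intro h
      refine ⟨{s ∈ X | gsat M φ (fun k i => {_a | B k i}) s},
        {s ∈ X | gsat M ψ (fun k i => {_a | B k i}) s}, ?_, fun s hs => hs.2, fun s hs => hs.2⟩
      ext s
      have := h s
      simp only [Set.mem_union, Set.mem_ofPred_eq]
      tauto
  | ex v φ ih =>
    simp only [pointForm, ih, gsat]
    refine forall₂_congr fun s _ => ⟨fun h => ⟨s 0, ?_⟩, fun ⟨m, h⟩ => ?_⟩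
    · rwa [Subsingleton.elim (Function.update s v (s 0)) s]
    · rwa [Subsingleton.elim s (Function.update s v m)]
  | all v φ ih =>
    simp only [pointForm, ih, gsat]
    refine forall₂_congr fun s _ => ⟨fun h m => ?_, fun h => ?_⟩
    · rwa [Subsingleton.elim (Function.update s v m) s]
    · rw [Subsingleton.elim s (Function.update s v (s 0))]
      exact h _
  | gfp i n xs φ ts ih =>
    simp only [pointForm, ih, gsat]
    have key : updI (fun k j => {_a : Fin k → M | B k j}) n i Set.univ =
        fun k j => {_a | (k = n ∧ j = i) ∨ B k j} := by
      funext k j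
      ext a
      simp only [updI, Set.mem_univ, Set.mem_ofPred_eq]
      split_ifs with h <;> simp [h]
    rw [← key]
    refine forall₂_congr fun s _ => ⟨fun h => ⟨Set.univ, fun a _ => ?_, Set.mem_univ _⟩, ?_⟩
    · change gsat M φ _ _
      rwa [Subsingleton.elim (updVec s xs a) s]
    · rintro ⟨Q, hQ, hm⟩
      have : Q = Set.univ := Set.eq_univ_of_forall fun a => by
        rwa [Subsingleton.elim a (fun j => (ts j).realize s)]
      subst this
      have h := hQ hm
      change gsat M φ _ _ at h
      rwa [Subsingleton.elim (updVec s xs _) s] at h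

/-! ### Structures with at least two elements -/

/-- The relation of arity `k` stored by the team `X` in the block of variables starting at `b`,
with parameters the values under `s` of the variables below `d`.  Such a block consists of `d`
parameters, a tuple of length `k`, and two variables whose equality marks membership. -/
def blockRel (X : Set (ℕ → M)) (b d k : ℕ) (s : ℕ → M) : Set (Fin k → M) :=
  {a | ∃ t ∈ X, (∀ j < d, t (b + j) = s j) ∧ (∀ j : Fin k, t (b + d + j) = a j) ∧
    t (b + d + k) = t (b + d + k + 1)}

/-- The interpretation of relation variables stored by the team `X` in the blocks `env`. -/
def teamInterp (X : Set (ℕ → M)) (env : ℕ → ℕ → Option (ℕ × ℕ)) (s : ℕ → M) : RelInterp M :=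
  fun k i => {a | ∃ p ∈ env k i, a ∈ blockRel X p.1 p.2 k s}

/-- Every assignment in `X` agrees with one in `Z` on the variables in `[K, f)`. -/
def ColLE (K f : ℕ) (X Z : Set (ℕ → M)) : Prop :=
  ∀ x ∈ X, ∃ z ∈ Z, ∀ v, K ≤ v → v < f → z v = x v

theorem ColLE.trans {K f : ℕ} {X Y Z : Set (ℕ → M)} (h1 : ColLE K f X Y) (h2 : ColLE K f Y Z) :
    ColLE K f X Z := by
  intro x hx
  obtain ⟨y, hy, hxy⟩ := h1 x hx
  obtain ⟨z, hz, hyz⟩ := h2 y hy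
  exact ⟨z, hz, fun v h h' => (hyz v h h').trans (hxy v h h')⟩

theorem Extends.colLE {a k K f : ℕ} {X Y : Set (ℕ → M)} (h : Extends a k X Y)
    (hd : f ≤ a ∨ a + k ≤ K) : ColLE K f X Y := by
  intro x hx
  obtain ⟨y, hy, hxy⟩ := h.2 x hx
  exact ⟨y, hy, fun v h h' => hxy v (by omega)⟩

theorem Extends.colLE_symm {a k K f : ℕ} {X Y : Set (ℕ → M)} (h : Extends a k X Y)
    (hd : f ≤ a ∨ a + k ≤ K) : ColLE K f Y X := by
  intro y hy
  obtain ⟨x, hx, hxy⟩ := h.1 y hy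
  exact ⟨x, hx, fun v h h' => (hxy v (by omega)).symm⟩

theorem blockRel_subset {K f b d k : ℕ} {X Z : Set (ℕ → M)} {s z : ℕ → M} (h : ColLE K f X Z)
    (hs : ∀ j < d, z j = s j) (hb : K ≤ b) (hf : b + d + k + 2 ≤ f) :
    blockRel X b d k s ⊆ blockRel Z b d k z := by
  rintro a ⟨x, hx, h1, h2, h3⟩
  obtain ⟨y, hy, hxy⟩ := h x hx
  refine ⟨y, hy, fun j hj => ?_, fun j => ?_, ?_⟩
  · rw [hxy _ (by omega) (by omega), h1 j hj, hs j hj]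
  · rw [hxy _ (by omega) (by omega), h2 j]
  · rw [hxy _ (by omega) (by omega), hxy _ (by omega) (by omega), h3]

/-- The blocks in `env` lie in `[K, f)` and have at most `d` parameters. -/
def EnvWF (K d f : ℕ) (env : ℕ → ℕ → Option (ℕ × ℕ)) : Prop :=
  ∀ k i, ∀ p ∈ env k i, K ≤ p.1 ∧ p.2 ≤ d ∧ p.1 + p.2 + k + 2 ≤ f

theorem EnvWF.mono {K d f d' f' : ℕ} {env : ℕ → ℕ → Option (ℕ × ℕ)} (h : EnvWF K d f env)
    (hd : d ≤ d') (hf : f ≤ f') : EnvWF K d' f' env := by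
  intro k i p hp
  have := h k i p hp
  omega

theorem teamInterp_subset {K d f : ℕ} {env : ℕ → ℕ → Option (ℕ × ℕ)} (he : EnvWF K d f env)
    {X Z : Set (ℕ → M)} {s z : ℕ → M} (h : ColLE K f X Z) (hs : ∀ j < d, z j = s j) (k i : ℕ) :
    teamInterp X env s k i ⊆ teamInterp Z env z k i := by
  rintro a ⟨p, hp, ha⟩
  obtain ⟨h1, h2, h3⟩ := he k i p hp
  exact ⟨p, hp, blockRel_subset h (fun j hj => hs j (by omega)) h1 h3 ha⟩

theorem teamInterp_congr {K d f : ℕ} {env : ℕ → ℕ → Option (ℕ × ℕ)} (he : EnvWF K d f env)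
    {X Z : Set (ℕ → M)} {s z : ℕ → M} (h : ColLE K f X Z) (h' : ColLE K f Z X)
    (hs : ∀ j < d, z j = s j) : teamInterp Z env z = teamInterp X env s := by
  funext k i
  exact Subset.antisymm (teamInterp_subset he h' (fun j hj => (hs j hj).symm) k i)
    (teamInterp_subset he h hs k i)

theorem teamInterp_extends {K d f a k : ℕ} {env : ℕ → ℕ → Option (ℕ × ℕ)} (he : EnvWF K d f env)
    {X Z : Set (ℕ → M)} {s z : ℕ → M} (h : Extends a k X Z) (hsz : AgreeOff a k s z)
    (hd : f ≤ a ∨ a + k ≤ K) (hda : d ≤ a) : teamInterp Z env z = teamInterp X env s :=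
  teamInterp_congr he (h.colLE hd) (h.colLE_symm hd) fun j hj => hsz j (by omega)

/-- Add to `env` a block for the relation variable `i` of arity `n`. -/
def addBlock (env : ℕ → ℕ → Option (ℕ × ℕ)) (n i : ℕ) (p : ℕ × ℕ) : ℕ → ℕ → Option (ℕ × ℕ) :=
  fun k j => if k = n ∧ j = i then some p else env k j

theorem teamInterp_addBlock (X : Set (ℕ → M)) (env : ℕ → ℕ → Option (ℕ × ℕ)) (n i : ℕ)
    (p : ℕ × ℕ) (s : ℕ → M) : teamInterp X (addBlock env n i p) s =
      updI (teamInterp X env s) n i (blockRel X p.1 p.2 n s) := by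
  funext k j
  ext a
  by_cases h : k = n ∧ j = i
  · obtain ⟨rfl, rfl⟩ := h
    simp [teamInterp, addBlock, updI]
  · simp [teamInterp, addBlock, updI, h]

/-- Under the guard `g`, the tuple `ts` belongs to the relation stored in the block at `b` with the
current parameters.  The variables from `f` on are auxiliary. -/
def callForm (b d f g : ℕ) {k : ℕ} (ts : Fin k → L.Term ℕ) : IncForm L :=
  exBlock f (d + k + 2)
    (.and
      (.incl (fun j : Fin (d + k + 2) => .var (f + j)) fun j : Fin (d + k + 2) => .var (b + j))
      (guarded g (eqs ((.var (f + d + k), .var (f + d + k + 1)) ::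
        ((List.range d).map (fun j => (.var (f + j), .var j)) ++
          (List.finRange k).map fun j => (.var (f + d + j), ts j))))))

theorem teamSat_callForm [L.Structure M] {K b d f g k : ℕ} {ρ : ℕ → ℕ} (hρ : ∀ v, ρ v < K)
    (hb : K ≤ b) (hf : b + d + k + 2 ≤ f) (hd : d ≤ K) (hg : g + 1 < f)
    (ts : Fin k → L.Term ℕ) (X : Set (ℕ → M)) :
    teamSat M (callForm b d f g fun j => (ts j).relabel ρ) X ↔
      ∀ s ∈ X, s g = s (g + 1) → (fun j => (ts j).realize (s ∘ ρ)) ∈ blockRel X b d k s := by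
  have hρs : ∀ s t : ℕ → M, AgreeOff f (d + k + 2) s t → t ∘ ρ = s ∘ ρ := fun s t h =>
    funext fun v => h _ (by have := hρ v; omega)
  simp only [callForm, teamSat_exBlock, teamSat, teamSat_guarded (teamSat_eqs _),
    List.forall_mem_cons, List.forall_mem_append, List.forall_mem_map, List.mem_range,
    List.mem_finRange, Term.realize_var, Term.realize_relabel, true_imp_iff]
  constructor
  · rintro ⟨Y, hXY, h1, h2⟩ s hs hsg
    obtain ⟨t, ht, hst⟩ := hXY.2 s hs
    obtain ⟨h3, h4, h5⟩ := h2 t ht (by rwa [hst _ (by omega), hst _ (by omega)])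
    obtain ⟨t', ht', h6⟩ := h1 t ht
    obtain ⟨s', hs', hst'⟩ := hXY.1 t' ht'
    have h7 : ∀ j < d + k + 2, s' (b + j) = t (f + j) := fun j hj => by
      rw [h6 ⟨j, hj⟩, hst' _ (by simp only; omega)]
    refine ⟨s', hs', fun j hj => ?_, fun j => ?_, ?_⟩
    · rw [h7 _ (by omega), h4 j hj, hst _ (by omega)]
    · rw [add_assoc, h7 _ (by omega), ← add_assoc, h5 j, hρs s t hst]
    · rw [show b + d + k + 1 = b + (d + k + 1) by omega, show b + d + k = b + (d + k) by omega,
        h7 _ (by omega), h7 _ (by omega), ← add_assoc, h3]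
      congr 1
      omega
  · intro h
    have key : ∀ s ∈ X, ∃ s' ∈ X, s g = s (g + 1) → (∀ j < d, s' (b + j) = s j) ∧
        (∀ j : Fin k, s' (b + d + j) = (ts j).realize (s ∘ ρ)) ∧
        s' (b + d + k) = s' (b + d + k + 1) := by
      intro s hs
      by_cases hg : s g = s (g + 1)
      · obtain ⟨s', hs', h'⟩ := h s hs hg
        exact ⟨s', hs', fun _ => h'⟩
      · exact ⟨s, hs, fun h => absurd h hg⟩
    choose! c hcX hc using key
    have hXY := extends_setOf (a := f) (k := d + k + 2) (X := X)
      (P := fun s t => ∀ j < d + k + 2, t (f + j) = c s (b + j)) fun s _ =>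
        ⟨override s f (d + k + 2) fun j => c s (b + j), agreeOff_override _ _ _ _,
          fun j hj => override_add _ _ _ _ hj⟩
    refine ⟨_, hXY, ?_, ?_⟩
    · rintro t ⟨s, hs, hst, ht⟩
      obtain ⟨t', ht', hst'⟩ := hXY.2 _ (hcX s hs)
      exact ⟨t', ht', fun j => by rw [ht j j.2, hst' _ (by omega)]⟩
    · rintro t ⟨s, hs, hst, ht⟩ htg
      obtain ⟨h1, h2, h3⟩ := hc s hs (by rwa [hst _ (by omega), hst _ (by omega)] at htg)
      refine ⟨?_, fun j hj => ?_, fun j => ?_⟩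
      · rw [show f + d + k + 1 = f + (d + k + 1) by omega, show f + d + k = f + (d + k) by omega,
          ht _ (by omega), ht _ (by omega), ← add_assoc, h3]
        congr 1
        omega
      · rw [ht j (by omega), h1 j hj, hst j (by omega)]
      · rw [add_assoc, ht _ (by omega), ← add_assoc, h2 j, hρs s t hst]

open Classical in
/-- Redirect the variables `xs` to the variables from `d` on. -/
noncomputable def bindVars (ρ : ℕ → ℕ) (d : ℕ) {n : ℕ} (xs : Fin n → ℕ) : ℕ → ℕ :=
  fun v => if h : ∃ j, xs j = v then d + (h.choose : ℕ) else ρ v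

theorem comp_bindVars (s : ℕ → M) (ρ : ℕ → ℕ) (d : ℕ) {n : ℕ} (xs : Fin n → ℕ) :
    s ∘ bindVars ρ d xs = updVec (s ∘ ρ) xs fun j => s (d + j) := by
  funext v
  simp only [Function.comp, bindVars, updVec]
  split_ifs <;> rfl

/-- An upper bound for the number of bound variables simultaneously in scope in `φ`. -/
def scopeDepth : GFPForm L → ℕ
  | .and φ ψ => max (scopeDepth φ) (scopeDepth ψ)
  | .or φ ψ => max (scopeDepth φ) (scopeDepth ψ)
  | .ex _ φ => scopeDepth φ + 1
  | .all _ φ => scopeDepth φ + 1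
  | .gfp _ n _ φ _ => n + scopeDepth φ
  | _ => 0

/-- Translation into inclusion logic.  The variables below `d` hold the values of the variables of
the source formula, as directed by `ρ`; only assignments giving `g` and `g + 1` the same value are
relevant; `env` locates the blocks storing the relation variables; the variables from `f` on are
unused. -/
noncomputable def toInc : GFPForm L → ℕ → ℕ → ℕ → (ℕ → ℕ) → (ℕ → ℕ → Option (ℕ × ℕ)) → IncForm L
  | .rel R ts, _, _, g, ρ, _ => guarded g (.rel R fun i => (ts i).relabel ρ)
  | .nrel R ts, _, _, g, ρ, _ => guarded g (.nrel R fun i => (ts i).relabel ρ)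
  | .eq t u, _, _, g, ρ, _ => guarded g (.eq (t.relabel ρ) (u.relabel ρ))
  | .neq t u, _, _, g, ρ, _ => guarded g (.neq (t.relabel ρ) (u.relabel ρ))
  | @GFPForm.rvar _ i n ts, _, f, g, ρ, env =>
    match env n i with
    | none => .neq (.var g) (.var (g + 1))
    | some p => callForm p.1 p.2 f g fun j => (ts j).relabel ρ
  | .and φ ψ, d, f, g, ρ, env => .and (toInc φ d f g ρ env) (toInc ψ d f g ρ env)
  | .or φ ψ, d, f, g, ρ, env =>
    exBlock f 4 (.and
      (guarded g (.or (.eq (.var f) (.var (f + 1))) (.eq (.var (f + 2)) (.var (f + 2 + 1)))))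
      (.and (toInc φ d (f + 4) f ρ env) (toInc ψ d (f + 4) (f + 2) ρ env)))
  | .ex v φ, d, f, g, ρ, env => exBlock d 1 (toInc φ (d + 1) f g (Function.update ρ v d) env)
  | .all v φ, d, f, g, ρ, env => .all d (toInc φ (d + 1) f g (Function.update ρ v d) env)
  | .gfp i n xs φ ts, d, f, g, ρ, env =>
    exBlock f (d + n + 2) (.and
      (callForm f d (f + d + n + 2) g fun j => (ts j).relabel ρ)
      (exBlock 0 (d + n) (.and
        (eqs ((List.range (d + n)).map fun j => (.var j, .var (f + j))))
        (toInc φ (d + n) (f + d + n + 2) (f + d + n) (bindVars ρ d xs)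
          (addBlock env n i (f, d))))))

/-- The translation `toInc φ` is correct on `M`: a team satisfies it iff every guarded assignment
satisfies `φ` under the interpretation stored by the team. -/
def Translates (M : Type*) [L.Structure M] (φ : GFPForm L) : Prop :=
  ∀ (K d f g : ℕ) (ρ : ℕ → ℕ) (env : ℕ → ℕ → Option (ℕ × ℕ)) (X : Set (ℕ → M)),
    d + scopeDepth φ ≤ K → K ≤ g → g + 1 < f → (∀ v, ρ v < d) → EnvWF K d f env →
    (teamSat M (toInc φ d f g ρ env) X ↔
      ∀ s ∈ X, s g = s (g + 1) → gsat M φ (teamInterp X env s) (s ∘ ρ))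

theorem translates_or [L.Structure M] [Nontrivial M] {φ ψ : GFPForm L} (h1 : Translates M φ)
    (h2 : Translates M ψ) : Translates M (.or φ ψ) := by
  classical
  intro K d f g ρ env X hK hg hf hρ he
  simp only [scopeDepth] at hK
  have e1 := fun Y : Set (ℕ → M) => h1 K d (f + 4) f ρ env Y (by omega) (by omega) (by omega) hρ
    (he.mono le_rfl (by omega))
  have e2 := fun Y : Set (ℕ → M) => h2 K d (f + 4) (f + 2) ρ env Y (by omega) (by omega) (by omega)
    hρ (he.mono le_rfl (by omega))
  have hor : ∀ X : Set (ℕ → M), teamSat M (L := L)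
      (.or (.eq (.var f) (.var (f + 1))) (.eq (.var (f + 2)) (.var (f + 2 + 1)))) X ↔
      ∀ s ∈ X, s f = s (f + 1) ∨ s (f + 2) = s (f + 2 + 1) := by
    intro X
    simp only [teamSat, Term.realize_var]
    constructor
    · rintro ⟨Y, Z, rfl, hY, hZ⟩ s (hs | hs)
      · exact Or.inl (hY s hs)
      · exact Or.inr (hZ s hs)
    · intro h
      refine ⟨{s ∈ X | s f = s (f + 1)}, {s ∈ X | s (f + 2) = s (f + 2 + 1)}, ?_,
        fun s hs => hs.2, fun s hs => hs.2⟩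
      ext s
      have := h s
      simp only [Set.mem_union, Set.mem_ofPred_eq]
      tauto
  have hρs : ∀ s t : ℕ → M, AgreeOff f 4 s t → t ∘ ρ = s ∘ ρ := fun s t h =>
    funext fun v => h _ (by have := hρ v; omega)
  simp only [toInc, teamSat_exBlock]
  simp only [teamSat, teamSat_guarded hor, e1, e2, gsat]
  constructor
  · rintro ⟨Y, hXY, hY, hφ, hψ⟩ s hs hsg
    obtain ⟨t, ht, hst⟩ := hXY.2 s hs
    rw [← teamInterp_extends he hXY hst (by omega) (by omega), ← hρs s t hst]
    exact (hY t ht (by rwa [hst _ (by omega), hst _ (by omega)])).imp (hφ t ht) (hψ t ht)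
  · intro h
    obtain ⟨p, q, hpq⟩ := exists_pair_ne M
    have hXY := extends_setOf (a := f) (k := 4) (X := X)
      (P := fun s t =>
        (t f = t (f + 1) ↔ gsat M φ (teamInterp X env s) (s ∘ ρ)) ∧
        (t (f + 2) = t (f + 2 + 1) ↔ gsat M ψ (teamInterp X env s) (s ∘ ρ))) fun s _ => by
        refine ⟨override s f 4 fun j =>
          if j = 1 then if gsat M φ (teamInterp X env s) (s ∘ ρ) then p else q
          else if j = 3 then if gsat M ψ (teamInterp X env s) (s ∘ ρ) then p else q
          else p, agreeOff_override _ _ _ _, ?_, ?_⟩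
        · have h0 := override_add s f 4 (j := 0) (hj := by omega)
          rw [add_zero] at h0
          rw [h0, override_add _ _ _ _ (by omega)]
          by_cases hG : gsat M φ (teamInterp X env s) (s ∘ ρ) <;> simp [hG, hpq]
        · rw [add_assoc f 2 1, override_add _ _ _ _ (by omega), override_add _ _ _ _ (by omega)]
          by_cases hG : gsat M ψ (teamInterp X env s) (s ∘ ρ) <;> simp [hG, hpq]
    refine ⟨_, hXY, ?_, ?_, ?_⟩
    · rintro t ⟨s, hs, hst, h3, h4⟩ htg
      rw [h3, h4]
      exact h s hs (by rwa [hst _ (by omega), hst _ (by omega)] at htg)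
    · rintro t ⟨s, hs, hst, h3, h4⟩ htg
      rw [teamInterp_extends he hXY hst (by omega) (by omega), hρs s t hst]
      exact h3.1 htg
    · rintro t ⟨s, hs, hst, h3, h4⟩ htg
      rw [teamInterp_extends he hXY hst (by omega) (by omega), hρs s t hst]
      exact h4.1 htg

theorem comp_update_of_agreeOff {d : ℕ} {ρ : ℕ → ℕ} (hρ : ∀ v, ρ v < d) {s t : ℕ → M}
    (h : AgreeOff d 1 s t) (v : ℕ) :
    t ∘ Function.update ρ v d = Function.update (s ∘ ρ) v (t d) := by
  funext u
  by_cases hu : u = v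
  · subst hu; simp
  · simpa [hu] using h (ρ u) (Or.inl (hρ u))

theorem update_lt_succ {d : ℕ} {ρ : ℕ → ℕ} (hρ : ∀ v, ρ v < d) (v : ℕ) :
    ∀ u, Function.update ρ v d u < d + 1 := by
  intro u
  by_cases hu : u = v
  · subst hu; simp
  · simpa [hu] using (hρ u).trans (Nat.lt_succ_self d)

theorem translates_ex [L.Structure M] [Nonempty M] {φ : GFPForm L} (ih : Translates M φ) (v : ℕ) :
    Translates M (.ex v φ) := by
  intro K d f g ρ env X hK hg hf hρ he
  simp only [scopeDepth] at hK
  have e := fun Y : Set (ℕ → M) => ih K (d + 1) f g (Function.update ρ v d) env Y (by omega) hg hf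
    (update_lt_succ hρ v) (he.mono (by omega) le_rfl)
  simp only [toInc, teamSat_exBlock, e, gsat]
  constructor
  · rintro ⟨Y, hXY, hY⟩ s hs hsg
    obtain ⟨t, ht, hst⟩ := hXY.2 s hs
    refine ⟨t d, ?_⟩
    rw [← teamInterp_extends he hXY hst (by omega) le_rfl, ← comp_update_of_agreeOff hρ hst]
    exact hY t ht (by rwa [hst _ (by omega), hst _ (by omega)])
  · intro h
    have hXY := extends_setOf (a := d) (k := 1) (X := X)
      (P := fun s t => s g = s (g + 1) →
        gsat M φ (teamInterp X env s) (Function.update (s ∘ ρ) v (t d))) fun s hs => by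
        by_cases hsg : s g = s (g + 1)
        · obtain ⟨m, hm⟩ := h s hs hsg
          exact ⟨Function.update s d m, agreeOff_update _ _ _, fun _ => by simpa using hm⟩
        · exact ⟨s, fun _ _ => rfl, fun h => absurd h hsg⟩
    refine ⟨_, hXY, ?_⟩
    rintro t ⟨s, hs, hst, hP⟩ htg
    rw [teamInterp_extends he hXY hst (by omega) le_rfl, comp_update_of_agreeOff hρ hst]
    exact hP (by rwa [hst _ (by omega), hst _ (by omega)] at htg)

theorem translates_all [L.Structure M] {φ : GFPForm L} (ih : Translates M φ) (v : ℕ) :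
    Translates M (.all v φ) := by
  intro K d f g ρ env X hK hg hf hρ he
  simp only [scopeDepth] at hK
  have e := fun Y : Set (ℕ → M) => ih K (d + 1) f g (Function.update ρ v d) env Y (by omega) hg hf
    (update_lt_succ hρ v) (he.mono (by omega) le_rfl)
  have hXY := extends_dupTeam X d
  simp only [toInc, teamSat, e, gsat]
  constructor
  · intro h s hs hsg m
    have hst := agreeOff_update s d m
    have h' := h _ ⟨s, hs, m, rfl⟩ (by rwa [hst _ (by omega), hst _ (by omega)])
    rw [teamInterp_extends he hXY hst (by omega) le_rfl, comp_update_of_agreeOff hρ hst] at h'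
    simpa using h'
  · rintro h _ ⟨s, hs, m, rfl⟩ htg
    have hst := agreeOff_update s d m
    rw [teamInterp_extends he hXY hst (by omega) le_rfl, comp_update_of_agreeOff hρ hst]
    exact h s hs (by rwa [hst _ (by omega), hst _ (by omega)] at htg) _

theorem translates_gfp [L.Structure M] [Nontrivial M] {φ : GFPForm L} (ih : Translates M φ)
    (i n : ℕ) (xs : Fin n → ℕ) (ts : Fin n → L.Term ℕ) : Translates M (.gfp i n xs φ ts) := by
  classical
  intro K d f g ρ env X hK hg hf hρ he
  simp only [scopeDepth] at hK
  have hρ' : ∀ v, bindVars ρ d xs v < d + n := by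
    intro v
    unfold bindVars
    split_ifs with h
    · omega
    · have := hρ v
      omega
  have he' : EnvWF K (d + n) (f + d + n + 2) (addBlock env n i (f, d)) := by
    intro k j p hp
    unfold addBlock at hp
    split_ifs at hp with h
    · obtain rfl : (f, d) = p := by simpa using hp
      obtain ⟨rfl, rfl⟩ := h
      simp only
      omega
    · have := he k j p hp
      omega
  have e := fun Z : Set (ℕ → M) => ih K (d + n) (f + d + n + 2) (f + d + n) (bindVars ρ d xs)
    (addBlock env n i (f, d)) Z (by omega) (by omega) (by omega) hρ' he'
  have hc := fun Y : Set (ℕ → M) => teamSat_callForm (K := K) (b := f) (d := d)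
    (f := f + d + n + 2) (g := g) (ρ := ρ) (fun v => (hρ v).trans_le (by omega)) (by omega)
    (by omega) (by omega) (by omega) ts Y
  simp only [toInc, teamSat_exBlock, teamSat, hc, e, teamSat_eqs, List.forall_mem_map,
    List.mem_range, Term.realize_var, gsat, teamInterp_addBlock, comp_bindVars]
  have hcomp : ∀ s t : ℕ → M, (∀ j < d, t j = s j) → t ∘ ρ = s ∘ ρ := fun s t h =>
    funext fun v => h _ (hρ v)
  constructor
  · rintro ⟨Y, hXY, hcall, Z, hYZ, hZ, hφ⟩ s hs hsg
    obtain ⟨t, ht, hst⟩ := hXY.2 s hs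
    refine ⟨blockRel Y f d n t, ?_, ?_⟩
    · rintro a ⟨t', ht', h1, h2, h3⟩
      obtain ⟨z, hz, htz⟩ := hYZ.2 t' ht'
      have hz1 : ∀ j < d, z j = s j := fun j hj => by
        rw [hZ z hz j (by omega), htz _ (by omega), h1 j hj, hst _ (by omega)]
      have hz2 : (fun j : Fin n => z (d + j)) = a := funext fun j => by
        rw [hZ z hz _ (by omega), htz _ (by omega), ← add_assoc, h2 j]
      have h4 := hφ z hz (by rwa [htz _ (by omega), htz _ (by omega)])
      rw [hcomp s z hz1, hz2, teamInterp_congr he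
        ((hXY.colLE (by omega)).trans (hYZ.colLE (by omega)))
        ((hYZ.colLE_symm (by omega)).trans (hXY.colLE_symm (by omega))) hz1] at h4
      refine gsat_mono φ (updI_mono (fun _ _ => subset_rfl) n i ?_) h4
      refine blockRel_subset (K := K) (f := f + d + n + 2) (hYZ.colLE_symm (by omega))
        (fun j hj => ?_) (by omega) (by omega)
      rw [hz1 j hj, hst _ (by omega)]
    · rw [← hcomp s t fun j hj => hst _ (by omega)]
      exact hcall t ht (by rwa [hst _ (by omega), hst _ (by omega)])
  · intro h
    let U : (ℕ → M) → Set (Fin n → M) := fun p =>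
      ⋃₀ {Q | Q ⊆ {a | gsat M φ (updI (teamInterp X env p) n i Q) (updVec (p ∘ ρ) xs a)}}
    have hU : ∀ p, ∀ a ∈ U p,
        gsat M φ (updI (teamInterp X env p) n i (U p)) (updVec (p ∘ ρ) xs a) := by
      rintro p a ⟨Q, hQ, ha⟩
      exact gsat_mono φ (updI_mono (fun _ _ => subset_rfl) n i (Set.subset_sUnion_of_mem hQ))
        (hQ ha)
    have hUc : ∀ p p' : ℕ → M, (∀ j < d, p' j = p j) → U p' = U p := by
      intro p p' hp
      have hX : ColLE K f X X := fun x hx => ⟨x, hx, fun _ _ _ => rfl⟩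
      simp only [U, hcomp p p' hp, teamInterp_congr he hX hX hp]
    obtain ⟨p₀, q₀, hpq⟩ := exists_pair_ne M
    have hXY := extends_setOf (a := f) (k := d + n + 2) (X := X)
      (P := fun _ t => t (f + d + n) = t (f + d + n + 1) →
        (fun j : Fin n => t (f + d + j)) ∈ U fun j => t (f + j)) fun s _ => by
        refine ⟨override s f (d + n + 2) fun j => if j = d + n then p₀ else q₀,
          agreeOff_override _ _ _ _, fun h => ?_⟩
        rw [show f + d + n + 1 = f + (d + n + 1) by omega, show f + d + n = f + (d + n) by omega,
          override_add _ _ _ _ (by omega), override_add _ _ _ _ (by omega)] at h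
        simp [hpq] at h
    have hrow : ∀ s ∈ X, ∀ (p : ℕ → M), ∀ a ∈ U p, ∃ t, (∃ s ∈ X, AgreeOff f (d + n + 2) s t ∧
        (t (f + d + n) = t (f + d + n + 1) →
          (fun j : Fin n => t (f + d + j)) ∈ U fun j => t (f + j))) ∧
        (∀ j < d, t (f + j) = p j) ∧ (∀ j : Fin n, t (f + d + j) = a j) ∧
        t (f + d + n) = t (f + d + n + 1) := by
      intro s hs p a ha
      set t := override s f (d + n + 2) fun j =>
        if j < d then p j else if h : j - d < n then a ⟨j - d, h⟩ else p₀ with ht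
      have h1 : ∀ j < d, t (f + j) = p j := fun j hj => by
        rw [ht, override_add _ _ _ _ (by omega)]
        simp [hj]
      have h2 : ∀ j : Fin n, t (f + d + j) = a j := fun j => by
        rw [ht, add_assoc f d, override_add _ _ _ _ (by omega)]
        simp
      have h3 : t (f + d + n) = t (f + d + n + 1) := by
        rw [ht, show f + d + n + 1 = f + (d + n + 1) by omega,
          show f + d + n = f + (d + n) by omega,
          override_add _ _ _ _ (by omega), override_add _ _ _ _ (by omega)]
        have h4 : ¬ d + n + 1 < d := by omega
        have h5 : ¬ d + n + 1 - d < n := by omega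
        simp [h4, h5]
      refine ⟨t, ⟨s, hs, agreeOff_override _ _ _ _, fun _ => ?_⟩, h1, h2, h3⟩
      rw [hUc p _ h1, funext h2]
      exact ha
    have hYZ := fun Y : Set (ℕ → M) => extends_setOf (a := 0) (k := d + n) (X := Y)
      (P := fun t z => ∀ j < d + n, z j = t (f + j)) fun t _ =>
        ⟨override t 0 (d + n) fun j => t (f + j), agreeOff_override _ _ _ _, fun j hj => by
          have := override_add t 0 (d + n) (fun j => t (f + j)) hj
          rwa [zero_add] at this⟩
    refine ⟨_, hXY, ?_, _, hYZ _, ?_, ?_⟩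
    · rintro t ⟨s, hs, hst, -⟩ htg
      have hst' : ∀ j < d, t j = s j := fun j hj => hst _ (by omega)
      rw [hcomp s t hst']
      obtain ⟨t', ht', h1, h2⟩ := hrow s hs s _
        (h s hs (by rwa [hst _ (by omega), hst _ (by omega)] at htg))
      exact ⟨t', ht', fun j hj => by rw [h1 j hj, hst' j hj], h2⟩
    · rintro z ⟨t, ht, htz, hz⟩ j hj
      rw [hz j hj, htz _ (by omega)]
    · rintro z ⟨t, ⟨s, hs, hst, hP⟩, htz, hz⟩ hzg
      have hz1 : ∀ j < d, z j = t (f + j) := fun j hj => hz j (by omega)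
      have hz2 : (fun j : Fin n => z (d + j)) = fun j : Fin n => t (f + d + j) :=
        funext fun j => by rw [hz _ (by omega), add_assoc]
      rw [htz _ (by omega), htz _ (by omega)] at hzg
      rw [hcomp (fun j => t (f + j)) z hz1, hz2, teamInterp_congr he
        ((hXY.colLE (by omega)).trans ((hYZ _).colLE (by omega)))
        (((hYZ _).colLE_symm (by omega)).trans (hXY.colLE_symm (by omega)))
        (s := fun j => t (f + j)) hz1]
      refine gsat_mono φ (updI_mono (fun _ _ => subset_rfl) n i ?_) (hU _ _ (hP hzg))
      intro a ha
      refine blockRel_subset (K := K) (f := f + d + n + 2) ((hYZ _).colLE (by omega)) hz1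
        (by omega) (by omega) ?_
      exact hrow s hs _ a ha

theorem teamSat_toInc [L.Structure M] [Nontrivial M] (φ : GFPForm L) : Translates M φ := by
  induction φ with
  | rel R ts =>
    intro K d f g ρ env X _ _ _ _ _
    exact teamSat_guarded (fun X => by simp [teamSat, gsat]) X
  | nrel R ts =>
    intro K d f g ρ env X _ _ _ _ _
    exact teamSat_guarded (fun X => by simp [teamSat, gsat]) X
  | eq t u =>
    intro K d f g ρ env X _ _ _ _ _
    exact teamSat_guarded (fun X => by simp [teamSat, gsat]) X
  | neq t u =>
    intro K d f g ρ env X _ _ _ _ _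
    exact teamSat_guarded (fun X => by simp [teamSat, gsat]) X
  | @rvar i n ts =>
    intro K d f g ρ env X hK hg hf hρ he
    simp only [scopeDepth] at hK
    simp only [toInc, gsat, teamInterp, Set.mem_ofPred_eq]
    cases hp : env n i with
    | none => simp [teamSat]
    | some p =>
      obtain ⟨h1, h2, h3⟩ := he n i p hp
      simpa using teamSat_callForm (fun v => (hρ v).trans_le (by omega)) h1 h3 (by omega) hf ts X
  | and φ ψ h1 h2 =>
    intro K d f g ρ env X hK hg hf hρ he
    simp only [scopeDepth] at hK
    simp only [toInc, teamSat, gsat, h1 K d f g ρ env X (by omega) hg hf hρ he,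
      h2 K d f g ρ env X (by omega) hg hf hρ he]
    exact ⟨fun h s hs hg => ⟨h.1 s hs hg, h.2 s hs hg⟩,
      fun h => ⟨fun s hs hg => (h s hs hg).1, fun s hs hg => (h s hs hg).2⟩⟩
  | or φ ψ h1 h2 => exact translates_or h1 h2
  | ex v φ ih => exact translates_ex ih v
  | all v φ ih => exact translates_all ih v
  | gfp i n xs φ ts ih => exact translates_gfp ih i n xs ts

/-! ### Sentences -/

/-- The translation of a sentence, before closing it existentially: one disjunct for one-element
structures and one for all others. -/
noncomputable def openTranslation (θ : GFPForm L) : IncForm L :=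
  .or (.and (.all 0 (.all 1 (.eq (.var 0) (.var 1)))) (pointForm θ fun _ _ => False))
    (.and (.ex 0 (.ex 1 (.neq (.var 0) (.var 1))))
      (.and (.eq (.var (1 + scopeDepth θ)) (.var (1 + scopeDepth θ + 1)))
        (toInc θ 1 (1 + scopeDepth θ + 2) (1 + scopeDepth θ) (fun _ => 0) fun _ _ => none)))

theorem teamSat_openTranslation [L.Structure M] (θ : GFPForm L) (hfv : fvG θ = ∅)
    {Y : Set (ℕ → M)} (hne : Y.Nonempty) (s : ℕ → M) :
    (teamSat M (openTranslation θ) Y → gsat M θ (botI M) s) ∧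
      ((∀ t ∈ Y, t (1 + scopeDepth θ) = t (1 + scopeDepth θ + 1)) → gsat M θ (botI M) s →
        teamSat M (openTranslation θ) Y) := by
  have hsent : ∀ t : ℕ → M, gsat M θ (botI M) t ↔ gsat M θ (botI M) s := fun t =>
    gsat_congr θ _ (by simp [hfv])
  rcases subsingleton_or_nontrivial M with hM | hM
  · have hpt : ∀ X : Set (ℕ → M), teamSat M (pointForm θ fun _ _ => False) X ↔
        ∀ t ∈ X, gsat M θ (botI M) t := teamSat_pointForm θ _
    constructor
    · rintro ⟨Y₁, Y₂, rfl, ⟨-, h⟩, ⟨⟨H, hH, H', hH', hneq⟩, -⟩⟩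
      obtain ⟨t, ht | ht⟩ := hne
      · exact (hsent t).1 ((hpt Y₁).1 h t ht)
      · obtain ⟨m, hm⟩ := hH t ht
        obtain ⟨m', hm'⟩ := hH' _ ⟨t, ht, m, hm, rfl⟩
        exact absurd (Subsingleton.elim _ _) (hneq _ ⟨_, ⟨t, ht, m, hm, rfl⟩, m', hm', rfl⟩)
    · intro _ h
      exact ⟨Y, ∅, (Set.union_empty Y).symm,
        ⟨fun _ _ => Subsingleton.elim _ _, (hpt Y).2 fun t _ => (hsent t).2 h⟩, teamSat_empty _⟩
  · have hbot : ∀ (X : Set (ℕ → M)) (t : ℕ → M),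
        teamInterp X (fun _ _ => none) t = botI M := by
      intro X t
      funext k i
      simp [teamInterp, botI]
    have htr : ∀ X : Set (ℕ → M), teamSat M (toInc θ 1 (1 + scopeDepth θ + 2) (1 + scopeDepth θ)
        (fun _ => 0) fun _ _ => none) X ↔
        ∀ t ∈ X, t (1 + scopeDepth θ) = t (1 + scopeDepth θ + 1) → gsat M θ (botI M) s := by
      intro X
      simp only [teamSat_toInc θ (1 + scopeDepth θ) 1 (1 + scopeDepth θ + 2) (1 + scopeDepth θ)
        (fun _ => 0) (fun _ _ => none) X le_rfl le_rfl (by omega) (by simp)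
        (by intro k i p hp; simp at hp), hbot, hsent]
    obtain ⟨p, q, hpq⟩ := exists_pair_ne M
    constructor
    · rintro ⟨Y₁, Y₂, rfl, ⟨hall, -⟩, ⟨-, hg, h⟩⟩
      obtain ⟨t, ht | ht⟩ := hne
      · have := hall _ ⟨_, ⟨t, ht, p, rfl⟩, q, rfl⟩
        simp [hpq] at this
      · exact (htr Y₂).1 h t ht (hg t ht)
    · intro hg h
      refine ⟨∅, Y, (Set.empty_union Y).symm, teamSat_empty _,
        ⟨fun _ => {p}, fun _ _ => Set.singleton_nonempty p, fun _ => {q},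
          fun _ _ => Set.singleton_nonempty q, ?_⟩, hg, (htr Y).2 fun _ _ _ => h⟩
      rintro _ ⟨_, ⟨t, -, _, rfl, rfl⟩, _, rfl, rfl⟩
      simpa using hpq

end TeamSem

open TeamSem in
/-- half of Corollary `incgfpeq`: for every PGFP sentence `θ` there is
an inclusion logic sentence `φ` over the same signature such that for all structures `M`:
`M ⊨ θ` iff `M ⊨ φ`. -/
theorem gfp_sentence_to_inc_sentence {L : Language} (θ : GFPForm L)
    (hfv : fvG θ = ∅) (hrv : rvG θ = ∅) :
    ∃ φ : IncForm L, fvInc φ = ∅ ∧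
      ∀ (M : Type*) [L.Structure M] [Nonempty M],
        (∀ s : ℕ → M, gsat M θ (botI M) s) ↔ incTrue M φ := by
  obtain ⟨F, hF, hθ⟩ : ∃ F, (∀ v ∈ fvInc (openTranslation θ), v < F) ∧ scopeDepth θ + 2 < F := by
    obtain ⟨F, hF⟩ := (finite_fvInc (openTranslation θ)).bddAbove
    exact ⟨F + scopeDepth θ + 3, fun v hv => by have := hF hv; omega, by omega⟩
  refine ⟨exBlock 0 F (openTranslation θ), ?_, fun M _ _ => forall_congr' fun s => ?_⟩
  · refine Set.eq_empty_of_forall_notMem fun v hv => ?_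
    obtain ⟨h1, h2⟩ := fvInc_exBlock _ _ _ hv
    exact h2 ⟨Nat.zero_le v, by simpa using hF v h1⟩
  · rw [teamSat_exBlock]
    constructor
    · intro h
      have hval : ∀ v < F, override s 0 F (fun _ => s 0) v = s 0 := fun v hv => by
        simp [override, hv]
      refine ⟨{override s 0 F fun _ => s 0}, ⟨?_, ?_⟩,
        (teamSat_openTranslation θ hfv (Set.singleton_nonempty _) s).2 ?_ h⟩
      · rintro _ rfl
        exact ⟨s, rfl, agreeOff_override _ _ _ _⟩
      · rintro _ rfl
        exact ⟨_, rfl, agreeOff_override _ _ _ _⟩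
      · rintro _ rfl
        rw [hval _ (by omega), hval _ (by omega)]
    · rintro ⟨Y, hY, h⟩
      obtain ⟨t, ht, -⟩ := hY.2 s rfl
      exact (teamSat_openTranslation θ hfv ⟨t, ht⟩ s).1 h
end

section
/- Let φ(R) be a first-order sentence over a signature Σ ∪ {R}, R an n-ary relation symbol, which defines a union-closed property of R: that is, for every Σ-structure M and every family (P_i)_{i∈I} of n-ary relations on dom(M) with (M, P_i) ⊨ φ for all i ∈ I, also (M, ⋃_{i∈I} P_i) ⊨ φ (in particular, taking I empty, (M, ∅) ⊨ φ). Then φ(R) is logically equivalent to some myopic sentence, i.e., to a sentence of the form ∀x̄ (Rx̄ → θ(R, x̄)) where θ is first-order and R occurs only positively in θ. -/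
open FirstOrder Language Set

namespace TeamSem

/-- The signature consisting of a single `n`-ary relation symbol `R`. -/
def LR (n : ℕ) : Language := ⟨fun _ => Empty, fun k => PLift (k = n)⟩

/-- The `n`-ary relation symbol `R` of `LR n`. -/
def Rsym (n : ℕ) : (LR n).Relations n := PLift.up rfl

/-- The `LR n`-structure on `M` interpreting `R` as the relation `P`. -/
def withRel {M : Type*} (n : ℕ) (P : Set (Fin n → M)) : (LR n).Structure M where
  funMap := fun f _ => f.elim
  RelMap := fun {_} r x => (fun j : Fin n => x (Fin.cast r.down.symm j)) ∈ P

/-- `satR L n M P φ` says that the expansion `(M, P)` of the `L`-structure `M`,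
interpreting the extra `n`-ary relation symbol `R` as `P`, satisfies the
first-order sentence `φ` over the signature `Σ ∪ {R}`. -/
def satR (L : Language) (n : ℕ) (M : Type*) [L.Structure M] (P : Set (Fin n → M))
    (φ : (L.sum (LR n)).Sentence) : Prop :=
  letI : (LR n).Structure M := withRel n P
  φ.Realize M

/-- `OnlyPos n φ b` says that in the first-order formula `φ` over `Σ ∪ {R}`, every
occurrence of the extra relation symbol `R` has polarity `b` (`b = true`: positive). -/
def OnlyPos {L : Language} (n : ℕ) :
    ∀ {α : Type} {k : ℕ}, (L.sum (LR n)).BoundedFormula α k → Bool → Prop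
  | _, _, .falsum, _ => True
  | _, _, .equal _ _, _ => True
  | _, _, .rel R _, b =>
      match R with
      | Sum.inl _ => True
      | Sum.inr _ => b = true
  | _, _, .imp f g, b => OnlyPos n f (!b) ∧ OnlyPos n g b
  | _, _, .all f, b => OnlyPos n f b

/-- The myopic sentence `∀x̄ (Rx̄ → θ(R, x̄))`. -/
def myopic {L : Language} (n : ℕ) (θ : (L.sum (LR n)).BoundedFormula Empty n) :
    (L.sum (LR n)).Sentence :=
  (BoundedFormula.imp
    (BoundedFormula.rel (Sum.inr (Rsym n)) (fun j => Term.var (Sum.inr j))) θ).alls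

end TeamSem

namespace TeamSem

section OnlyPos

variable {L : Language} {n : ℕ} {α β : Type}

@[simp]
theorem onlyPos_falsum {k : ℕ} (b : Bool) :
    OnlyPos n (.falsum : (L.sum (LR n)).BoundedFormula α k) b := by
  rw [OnlyPos]; trivial

@[simp]
theorem onlyPos_equal {k : ℕ} (t u : (L.sum (LR n)).Term (α ⊕ Fin k)) (b : Bool) :
    OnlyPos n (.equal t u) b := by
  rw [OnlyPos]; trivial

@[simp]
theorem onlyPos_rel_inl {k l : ℕ} (R : L.Relations l)
    (ts : Fin l → (L.sum (LR n)).Term (α ⊕ Fin k)) (b : Bool) :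
    OnlyPos n (.rel (Sum.inl R) ts) b := by
  rw [OnlyPos]; trivial

@[simp]
theorem onlyPos_rel_inr {k l : ℕ} (R : (LR n).Relations l)
    (ts : Fin l → (L.sum (LR n)).Term (α ⊕ Fin k)) (b : Bool) :
    OnlyPos n (.rel (Sum.inr R) ts) b ↔ b = true := by
  rw [OnlyPos]

@[simp]
theorem onlyPos_imp {k : ℕ} (f g : (L.sum (LR n)).BoundedFormula α k) (b : Bool) :
    OnlyPos n (f.imp g) b ↔ OnlyPos n f (!b) ∧ OnlyPos n g b := by
  rw [OnlyPos]

@[simp]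
theorem onlyPos_all {k : ℕ} (f : (L.sum (LR n)).BoundedFormula α (k + 1)) (b : Bool) :
    OnlyPos n f.all b ↔ OnlyPos n f b := by
  rw [OnlyPos]

theorem onlyPos_castLE {k m : ℕ} (h : k ≤ m) (f : (L.sum (LR n)).BoundedFormula α k) (b : Bool)
    (hf : OnlyPos n f b) : OnlyPos n (f.castLE h) b := by
  induction f generalizing m b with
  | falsum => simp [BoundedFormula.castLE]
  | equal => simp [BoundedFormula.castLE]
  | rel R ts => cases R <;> simp_all [BoundedFormula.castLE]
  | imp f g ihf ihg =>
    rw [onlyPos_imp] at hf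
    exact (onlyPos_imp _ _ _).2 ⟨ihf h _ hf.1, ihg h _ hf.2⟩
  | all f ih => exact (onlyPos_all _ _).2 (ih _ _ ((onlyPos_all _ _).1 hf))

theorem onlyPos_relabel {k m : ℕ} (g : α → β ⊕ Fin m) (f : (L.sum (LR n)).BoundedFormula α k)
    (b : Bool) (hf : OnlyPos n f b) : OnlyPos n (f.relabel g) b := by
  induction f generalizing b with
  | falsum => simp
  | equal => simp [BoundedFormula.relabel, BoundedFormula.mapTermRel]
  | rel R ts =>
    rcases R with R | R
    · exact onlyPos_rel_inl _ _ _
    · exact (onlyPos_rel_inr _ _ _).2 ((onlyPos_rel_inr _ _ _).1 hf)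
  | imp f g ihf ihg =>
    rw [onlyPos_imp] at hf
    exact (onlyPos_imp _ _ _).2 ⟨ihf _ hf.1, ihg _ hf.2⟩
  | all f ih =>
    refine (onlyPos_all _ _).2 ?_
    exact onlyPos_castLE _ _ _ (ih _ (by simpa using hf))

theorem onlyPos_restrictFreeVar [DecidableEq α] {k : ℕ} (f : (L.sum (LR n)).BoundedFormula α k)
    (g : f.freeVarFinset → β) (b : Bool) (hf : OnlyPos n f b) :
    OnlyPos n (f.restrictFreeVar g) b := by
  induction f generalizing b with
  | falsum => simp [BoundedFormula.restrictFreeVar]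
  | equal => simp [BoundedFormula.restrictFreeVar]
  | rel R ts => cases R <;> simp_all [BoundedFormula.restrictFreeVar]
  | imp f g ihf ihg =>
    rw [onlyPos_imp] at hf
    exact (onlyPos_imp _ _ _).2 ⟨ihf _ _ hf.1, ihg _ _ hf.2⟩
  | all f ih =>
    rw [BoundedFormula.restrictFreeVar, onlyPos_all]
    exact ih _ _ (by simpa using hf)

theorem onlyPos_alls {k : ℕ} (f : (L.sum (LR n)).BoundedFormula α k) (b : Bool)
    (hf : OnlyPos n f b) : OnlyPos n f.alls b := by
  induction k with
  | zero => exact hf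
  | succ k ih => exact ih f.all (by simpa using hf)

theorem onlyPos_not {k : ℕ} (f : (L.sum (LR n)).BoundedFormula α k) (b : Bool)
    (hf : OnlyPos n f (!b)) : OnlyPos n f.not b :=
  (onlyPos_imp _ _ _).2 ⟨hf, onlyPos_falsum b⟩

theorem onlyPos_inf {k : ℕ} (f g : (L.sum (LR n)).BoundedFormula α k) (b : Bool)
    (hf : OnlyPos n f b) (hg : OnlyPos n g b) : OnlyPos n (f ⊓ g) b :=
  onlyPos_not _ _ ((onlyPos_imp _ _ _).2 ⟨by simpa using hf, onlyPos_not _ _ (by simpa using hg)⟩)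

theorem onlyPos_top {k : ℕ} (b : Bool) :
    OnlyPos n (⊤ : (L.sum (LR n)).BoundedFormula α k) b :=
  onlyPos_not _ _ (onlyPos_falsum _)

theorem onlyPos_iInf {ι : Type*} [Finite ι] {k : ℕ} (f : ι → (L.sum (LR n)).BoundedFormula α k)
    (b : Bool) (hf : ∀ i, OnlyPos n (f i) b) : OnlyPos n (BoundedFormula.iInf f) b := by
  have key (l : List ι) : OnlyPos n ((l.map f).foldr (· ⊓ ·) ⊤) b := by
    induction l with
    | nil => exact onlyPos_top b
    | cons i l ih => exact onlyPos_inf _ _ _ (hf i) ih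
  exact key _

theorem onlyPos_iAlls [Finite β] (f : (L.sum (LR n)).Formula (α ⊕ β)) (b : Bool)
    (hf : OnlyPos n f b) : OnlyPos n (Formula.iAlls β f) b :=
  onlyPos_alls _ _ (onlyPos_relabel _ _ _ hf)

theorem exists_onlyPos_forall (w : α) (θ : (L.sum (LR n)).Formula α) (b : Bool)
    (hθ : OnlyPos n θ b) : ∃ θ' : (L.sum (LR n)).Formula α, OnlyPos n θ' b ∧
      ∀ (M : Type) [(L.sum (LR n)).Structure M] (v : α → M),
        θ'.Realize v ↔ ∀ m, θ.Realize (fun a => open Classical in if a = w then m else v a) := by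
  classical
  refine ⟨Formula.iAlls Unit (θ.relabel fun a => if a = w then Sum.inr () else Sum.inl a),
    onlyPos_iAlls _ _ (onlyPos_relabel _ _ _ hθ), fun M _ v => ?_⟩
  have key : ∀ i : Unit → M, (Sum.elim v i ∘ fun a => if a = w then Sum.inr () else Sum.inl a) =
      fun a => if a = w then i () else v a := by
    intro i
    funext a
    by_cases h : a = w <;> simp [h]
  simp only [Formula.realize_iAlls, Formula.realize_relabel]
  constructor
  · intro h m
    rw [← key fun _ => m]
    exact h _
  · intro h i
    have := h (i ())
    rw [← key i] at this
    exact this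

theorem exists_onlyPos_exists (w : α) (θ : (L.sum (LR n)).Formula α) (b : Bool)
    (hθ : OnlyPos n θ b) : ∃ θ' : (L.sum (LR n)).Formula α, OnlyPos n θ' b ∧
      ∀ (M : Type) [(L.sum (LR n)).Structure M] (v : α → M),
        θ'.Realize v ↔ ∃ m, θ.Realize (fun a => open Classical in if a = w then m else v a) := by
  obtain ⟨θ', h, h'⟩ := exists_onlyPos_forall w θ.not (!b) (onlyPos_not _ _ (by simpa using hθ))
  refine ⟨θ'.not, onlyPos_not _ _ h, fun M _ v => ?_⟩
  rw [Formula.realize_not, h']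
  simp [Formula.realize_not]

/-- The `n`-ary relation interpreting `R` in a structure over `Σ ∪ {R}`. -/
def relOf (L : Language) (n : ℕ) (M : Type*) [(L.sum (LR n)).Structure M] : Set (Fin n → M) :=
  {x | Structure.RelMap (L := L.sum (LR n)) (Sum.inr (Rsym n)) x}

theorem structure_eq_sum {M : Type*} [S : (L.sum (LR n)).Structure M] :
    @sumStructure L (LR n) M ((LHom.sumInl : L →ᴸ L.sum (LR n)).reduct M)
      (withRel n (relOf L n M)) = S := by
  ext k f x
  · rcases f with f | f
    · rfl
    · exact f.elim
  · rcases f with f | f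
    · rfl
    · obtain ⟨h⟩ := f
      cases h
      rfl

theorem satR_relOf {M : Type*} [S : (L.sum (LR n)).Structure M] (φ : (L.sum (LR n)).Sentence) :
    @satR L n M ((LHom.sumInl : L →ᴸ L.sum (LR n)).reduct M) (relOf L n M) φ ↔ φ.Realize M := by
  unfold satR
  rw [structure_eq_sum]

theorem realize_myopic {M : Type*} [(L.sum (LR n)).Structure M]
    (θ : (L.sum (LR n)).BoundedFormula Empty n) :
    (myopic n θ).Realize M ↔ ∀ x ∈ relOf L n M, θ.Realize default x := by
  exact BoundedFormula.realize_alls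

end OnlyPos

section Compactness

theorem exists_realize_of_finite {L : FirstOrder.Language.{0, 0}} {C : Type} (T : Set (L.Formula C))
    (h : ∀ T₀ : Finset (L.Formula C), ↑T₀ ⊆ T → ∃ (M : Type) (_ : Nonempty M) (_ : L.Structure M)
      (v : C → M), ∀ f ∈ T₀, f.Realize v) :
    ∃ (M : Type) (_ : Nonempty M) (_ : L.Structure M) (v : C → M), ∀ f ∈ T, f.Realize v := by
  classical
  have : Theory.IsSatisfiable (L := L[[C]]) (Formula.equivSentence '' T) := by
    rw [Theory.isSatisfiable_iff_isFinitelySatisfiable]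
    intro T₀ hT₀
    obtain ⟨T₁, hT₁, rfl⟩ := Finset.subset_set_image_iff.1 hT₀
    obtain ⟨M, _, _, v, hv⟩ := h T₁ hT₁
    let : (constantsOn C).Structure M := constantsOn.structure v
    have : M ⊨ (↑(T₁.image Formula.equivSentence) : L[[C]].Theory) := by
      refine ⟨fun f hf => ?_⟩
      obtain ⟨f, hfT, rfl⟩ := Finset.mem_image.1 hf
      rw [Formula.realize_equivSentence]
      exact hv f hfT
    exact Theory.Model.isSatisfiable M
  obtain ⟨M⟩ := this
  let : L.Structure M := (lhomWithConstants L C).reduct M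
  have : (lhomWithConstants L C).IsExpansionOn M := LHom.isExpansionOn_reduct _ _
  refine ⟨M, inferInstance, inferInstance, fun a => (L.con a : M), fun f hf => ?_⟩
  rw [← Formula.realize_equivSentence]
  exact M.is_model.realize_of_mem _ ⟨f, hf, rfl⟩

/-- A valuation whose range contains witnesses for all formulas has an elementary range. -/
theorem exists_surjective_realize {L : FirstOrder.Language.{0, 0}} {C M : Type} [Nonempty M]
    [L.Structure M]
    (v : C → M)
    (hv : ∀ (k : ℕ) (ψ : L.BoundedFormula Empty (k + 1)) (a : Fin k → C) (m : M),
      ψ.Realize default (Fin.snoc (v ∘ a) m : _ → M) →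
        ∃ w, ψ.Realize default (Fin.snoc (v ∘ a) (v w) : _ → M)) :
    ∃ (N : Type) (_ : Nonempty N) (_ : L.Structure N) (u : C → N), Function.Surjective u ∧
      ∀ f : L.Formula C, f.Realize u ↔ f.Realize v := by
  classical
  let S : L.Substructure M :=
    { carrier := Set.range v
      fun_mem := by
        intro k f x hx
        choose a ha using hx
        obtain ⟨w, hw⟩ := hv k (Term.bdEqual (.var (Sum.inr (Fin.last k)))
          (.func f fun i => .var (Sum.inr i.castSucc))) a (Structure.funMap f x) (by
            simp [ha])
        refine ⟨w, ?_⟩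
        simpa [ha] using hw }
  have hS : ∀ (k : ℕ) (ψ : L.BoundedFormula Empty (k + 1)) (x : Fin k → S) (m : M),
      ψ.Realize default (Fin.snoc ((↑) ∘ x) m : _ → M) →
        ∃ b : S, ψ.Realize default (Fin.snoc ((↑) ∘ x) b : _ → M) := by
    intro k ψ x m hm
    choose a ha using fun i => (x i).2
    have hx : v ∘ a = (↑) ∘ x := funext ha
    rw [← hx] at hm ⊢
    obtain ⟨w, hw⟩ := hv k ψ a m hm
    exact ⟨⟨v w, w, rfl⟩, hw⟩
  have hC : Nonempty C := by
    obtain ⟨w, -⟩ := hv 0 ⊤ Fin.elim0 (Classical.arbitrary M) (by simp)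
    exact ⟨w⟩
  refine ⟨S, ⟨⟨v hC.some, hC.some, rfl⟩⟩, inferInstance, fun a => ⟨v a, a, rfl⟩, ?_, ?_⟩
  · rintro ⟨_, a, rfl⟩
    exact ⟨a, rfl⟩
  · intro f
    exact ((S.toElementarySubstructure hS).subtype.map_formula f fun a => ⟨v a, a, rfl⟩).symm

end Compactness

section Witnesses

/-- Names for the elements of a model `(M, P)` (the hub) and of a family of models (the spokes),
one for each tuple of names. Every name is a Henkin witness, in the hub or in one of the spokes, for
a formula whose parameters are names. -/
inductive Witness (L : FirstOrder.Language.{0, 0}) (n : ℕ) : Type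
  | hub (k : ℕ) (ψ : (L.sum (LR n)).BoundedFormula Empty (k + 1)) (a : Fin k → Witness L n)
  | spoke (c : Fin n → Witness L n) (k : ℕ) (ψ : (L.sum (LR n)).BoundedFormula Empty (k + 1))
      (a : Fin k → Witness L n)

namespace Witness

variable {L : FirstOrder.Language.{0, 0}} {n : ℕ}

/-- The spoke a witness belongs to, if any. -/
def owner : Witness L n → Option (Fin n → Witness L n)
  | hub _ _ _ => none
  | spoke c _ _ _ => some c

/-- The number of parameters. -/
def arity : Witness L n → ℕ
  | hub k _ _ => k
  | spoke _ k _ _ => k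

/-- The formula to be witnessed. -/
def body : (w : Witness L n) → (L.sum (LR n)).BoundedFormula Empty (w.arity + 1)
  | hub _ ψ _ => ψ
  | spoke _ _ ψ _ => ψ

/-- The parameters of the formula to be witnessed. -/
def args : (w : Witness L n) → Fin w.arity → Witness L n
  | hub _ _ a => a
  | spoke _ _ _ a => a

/-- The depth of nesting of a witness. -/
def rank : Witness L n → ℕ
  | hub _ _ a => Finset.univ.sup (fun i => (a i).rank) + 1
  | spoke c _ _ a =>
    max (Finset.univ.sup fun i => (c i).rank) (Finset.univ.sup fun i => (a i).rank) + 1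

theorem rank_args_lt (w : Witness L n) (i : Fin w.arity) : (w.args i).rank < w.rank := by
  cases w with
  | hub k ψ a =>
    exact Nat.lt_succ_of_le (Finset.le_sup (f := fun i => (a i).rank) (Finset.mem_univ i))
  | spoke c k ψ a =>
    exact Nat.lt_succ_of_le (le_max_of_le_right
      (Finset.le_sup (f := fun i => (a i).rank) (Finset.mem_univ i)))

theorem rank_owner_lt (w : Witness L n) (c : Fin n → Witness L n) (h : w.owner = some c)
    (i : Fin n) : (c i).rank < w.rank := by
  cases w with
  | hub k ψ a => simp [owner] at h
  | spoke c' k ψ a =>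
    obtain rfl : c' = c := by simpa [owner] using h
    exact Nat.lt_succ_of_le (le_max_of_le_left
      (Finset.le_sup (f := fun i => (c' i).rank) (Finset.mem_univ i)))

instance : Nonempty (Witness L n) := ⟨hub 0 ⊤ Fin.elim0⟩

/-- The Henkin condition of a witness holds under a valuation. -/
def Holds {M : Type} [(L.sum (LR n)).Structure M] (v : Witness L n → M) (w : Witness L n) : Prop :=
  ∀ m, w.body.Realize default (Fin.snoc (v ∘ w.args) m : _ → M) →
    w.body.Realize default (Fin.snoc (v ∘ w.args) (v w) : _ → M)

/-- The Henkin condition of a witness. -/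
noncomputable def henkinFormula (w : Witness L n) : (L.sum (LR n)).Formula (Witness L n) :=
  Formula.iAlls Unit <|
    (w.body.toFormula.relabel
      (Sum.elim Empty.elim (Fin.snoc (fun i => Sum.inl (w.args i)) (Sum.inr ())))).imp
    (w.body.toFormula.relabel
      (Sum.elim Empty.elim (Fin.snoc (fun i => Sum.inl (w.args i)) (Sum.inl w))))

theorem realize_henkinFormula {M : Type} [(L.sum (LR n)).Structure M] (v : Witness L n → M)
    (w : Witness L n) : w.henkinFormula.Realize v ↔ w.Holds v := by
  have key (i : Unit → M) (b : Witness L n ⊕ Unit) :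
      (Sum.elim v i ∘ Sum.elim Empty.elim
        (Fin.snoc (fun i => Sum.inl (w.args i)) b)) ∘ Sum.inr =
        (Fin.snoc (v ∘ w.args) (Sum.elim v i b) : _ → M) := by
    funext j
    refine Fin.lastCases ?_ (fun j => ?_) j <;> simp
  simp only [henkinFormula, Formula.realize_iAlls, Formula.realize_imp, Formula.realize_relabel,
    BoundedFormula.realize_toFormula, key, Holds, Sum.elim_inl, Sum.elim_inr]
  constructor
  · intro h m
    convert h fun _ => m
  · intro h i
    convert h (i ())

theorem holds_congr {M : Type} [(L.sum (LR n)).Structure M] {u v : Witness L n → M}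
    {w : Witness L n} (h : u w = v w) (h' : ∀ i, u (w.args i) = v (w.args i)) :
    w.Holds u ↔ w.Holds v := by
  have : u ∘ w.args = v ∘ w.args := funext h'
  rw [Holds, Holds, this, h]

end Witness

variable {L : FirstOrder.Language.{0, 0}} {n : ℕ} (φ : (L.sum (LR n)).Sentence)

/-- A structure satisfies all myopic consequences of `φ`. -/
def SatMyopic (M : Type) [(L.sum (LR n)).Structure M] : Prop :=
  ∀ θ : (L.sum (LR n)).BoundedFormula Empty n, OnlyPos n θ true →
    (∀ (N : Type) [Nonempty N] [(L.sum (LR n)).Structure N], φ.Realize N →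
      (myopic n θ).Realize N) → (myopic n θ).Realize M

variable {φ}

theorem SatMyopic.realize {M : Type} [(L.sum (LR n)).Structure M] (hM : SatMyopic φ M)
    {α : Type} (c : Fin n → α) (θ : (L.sum (LR n)).Formula α) (hθ : OnlyPos n θ true)
    (h : ∀ (N : Type) [Nonempty N] [(L.sum (LR n)).Structure N] (v : α → N), φ.Realize N →
      v ∘ c ∈ relOf L n N → θ.Realize v)
    (v : α → M) (hv : v ∘ c ∈ relOf L n M) : θ.Realize v := by
  classical
  let s : Set α := ↑θ.freeVarFinset ∪ Set.range c
  have hs : (θ.freeVarFinset : Set α) ⊆ s := Set.subset_union_left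
  have hc (j : Fin n) : c j ∈ s := Or.inr ⟨j, rfl⟩
  have : Finite s := (θ.freeVarFinset.finite_toSet.union (Set.finite_range c)).to_subtype
  let θs : (L.sum (LR n)).Formula s := θ.restrictFreeVar (Set.inclusion hs)
  have hθs {N : Type} [(L.sum (LR n)).Structure N] (u : α → N) :
      θs.Realize (fun a => u a) ↔ θ.Realize u :=
    BoundedFormula.realize_restrictFreeVar' hs
  let e : (L.sum (LR n)).Formula (Fin n ⊕ s) := Formula.iInf fun j : Fin n =>
    Term.equal (.var (Sum.inl j)) (.var (Sum.inr ⟨c j, hc j⟩))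
  let χ : (L.sum (LR n)).Formula (Fin n) := Formula.iAlls s (e.imp (θs.relabel Sum.inr))
  have hχ {N : Type} [(L.sum (LR n)).Structure N] (x : Fin n → N) :
      (BoundedFormula.relabel Sum.inr χ : (L.sum (LR n)).BoundedFormula Empty n).Realize default x ↔
        ∀ y : s → N, (∀ j, x j = y ⟨c j, hc j⟩) → θs.Realize y := by
    rw [Formula.realize_relabel_sumInr]
    simp [χ, e, Function.comp_def]
  have hpos : OnlyPos n
      (BoundedFormula.relabel Sum.inr χ : (L.sum (LR n)).BoundedFormula Empty n) true :=
    onlyPos_relabel _ _ _ <| onlyPos_iAlls _ _ <| (onlyPos_imp _ _ _).2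
      ⟨onlyPos_iInf _ _ fun j => onlyPos_equal _ _ _,
        onlyPos_relabel _ _ _ (onlyPos_restrictFreeVar _ _ _ hθ)⟩
  have := hM _ hpos fun N _ _ hN => by
    rw [realize_myopic]
    intro x hx
    rw [hχ]
    intro y hy
    let u : α → N := fun a => if h : a ∈ s then y ⟨a, h⟩ else Classical.arbitrary N
    have huc : u ∘ c = x := by
      funext j
      simp [u, hc, hy]
    have huy : y = fun a : s => u a := by
      funext a
      simp [u]
    rw [huy, hθs]
    exact h N u hN (huc ▸ hx)
  rw [realize_myopic] at this
  exact (hθs v).1 ((hχ _).1 (this _ hv) _ fun j => rfl)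

variable (φ) in
/-- `φ`, `R c` and the Henkin conditions of the witnesses in `W` that belong to the spoke `c`
entail `θ`. -/
def Entails (W : Set (Witness L n)) (c : Fin n → Witness L n)
    (θ : (L.sum (LR n)).Formula (Witness L n)) : Prop :=
  ∀ (N : Type) [Nonempty N] [(L.sum (LR n)).Structure N] (v : Witness L n → N), φ.Realize N →
    v ∘ c ∈ relOf L n N → (∀ w ∈ W, w.owner = some c → w.Holds v) → θ.Realize v

open Classical in
theorem exists_holds_update {M : Type} [Nonempty M] [(L.sum (LR n)).Structure M]
    (v : Witness L n → M) (w : Witness L n) :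
    ∃ m, w.Holds (fun a => if a = w then m else v a) := by
  have hargs (m : M) : (fun a => if a = w then m else v a) ∘ w.args = v ∘ w.args := by
    funext i
    have : w.args i ≠ w := fun h => (w.rank_args_lt i).ne (by rw [h])
    simp [this]
  by_cases h : ∃ m, w.body.Realize default (Fin.snoc (v ∘ w.args) m : _ → M)
  · obtain ⟨m, hm⟩ := h
    refine ⟨m, fun _ _ => ?_⟩
    simpa [hargs] using hm
  · refine ⟨Classical.arbitrary M, fun m hm => ?_⟩
    rw [hargs] at hm
    exact (h ⟨m, hm⟩).elim

theorem SatMyopic.exists_valuation {M : Type} [Nonempty M] [(L.sum (LR n)).Structure M]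
    (hM : SatMyopic φ M) (W : Finset (Witness L n))
    (Θ : (Fin n → Witness L n) → (L.sum (LR n)).Formula (Witness L n))
    (hpos : ∀ c, OnlyPos n (Θ c) true) (hΘ : ∀ c, Entails φ W c (Θ c)) :
    ∃ v : Witness L n → M, (∀ w ∈ W, w.owner = none → w.Holds v) ∧
      ∀ c, v ∘ c ∈ relOf L n M → (Θ c).Realize v := by
  classical
  induction hW : W.card generalizing W Θ with
  | zero =>
    obtain rfl := Finset.card_eq_zero.1 hW
    refine ⟨fun _ => Classical.arbitrary M, by simp, fun c => ?_⟩
    exact hM.realize c (Θ c) (hpos c) (fun N _ _ v h h' => hΘ c N v h h' (by simp)) _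
  | succ k ih =>
    obtain ⟨w, hwW, hmax⟩ := W.exists_max_image Witness.rank
      (Finset.card_pos.1 (by omega))
    have hne (N : Type) (v : Witness L n → N) (m : N) (a : Witness L n) (ha : a.rank < w.rank) :
        (if a = w then m else v a) = v a := if_neg fun h => ha.ne (by rw [h])
    have hupd {N : Type} [(L.sum (LR n)).Structure N] (v : Witness L n → N) (m : N)
        (u : Witness L n) (hu : u ∈ W) (huw : u ≠ w) :
        u.Holds (fun a => if a = w then m else v a) ↔ u.Holds v :=
      Witness.holds_congr (if_neg huw) fun i =>
        hne N v m _ ((u.rank_args_lt i).trans_le (hmax u hu))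
    have hcomp {N : Type} (v : Witness L n → N) (m : N) (c : Fin n → Witness L n)
        (hc : w ∉ Set.range c) : (fun a => if a = w then m else v a) ∘ c = v ∘ c :=
      funext fun i => if_neg fun h => hc ⟨i, h⟩
    have hrange (c : Fin n → Witness L n) (hc : w ∈ Set.range c) (u : Witness L n) (hu : u ∈ W) :
        u.owner ≠ some c := by
      intro h
      obtain ⟨i, rfl⟩ := hc
      exact (u.rank_owner_lt c h i).not_ge (hmax u hu)
    choose A hApos hA using fun c => exists_onlyPos_forall w (Θ c) true (hpos c)
    choose E hEpos hE using fun c => exists_onlyPos_exists w (Θ c) true (hpos c)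
    obtain ⟨v, hv, hvΘ⟩ := ih (W.erase w)
      (fun c => if w ∈ Set.range c then ⊤ else if w.owner = some c then E c else A c)
      (fun c => by
        split_ifs
        exacts [onlyPos_top _, hEpos c, hApos c])
      (fun c => by
        intro N _ _ v hN hRc hH
        split_ifs with h1 h2
        · exact Formula.realize_top.2 trivial
        · rw [hE]
          obtain ⟨m, hm⟩ := exists_holds_update v w
          refine ⟨m, hΘ c N _ hN (by rwa [hcomp v m c h1]) fun u hu huc => ?_⟩
          by_cases huw : u = w
          · rw [huw]
            exact hm
          · exact (hupd v m u hu huw).2 (hH u (by simpa [huw] using hu) huc)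
        · rw [hA]
          intro m
          refine hΘ c N _ hN (by rwa [hcomp v m c h1]) fun u hu huc => ?_
          have huw : u ≠ w := fun h => h2 (h ▸ huc)
          exact (hupd v m u hu huw).2 (hH u (by simpa [huw] using hu) huc))
      (by rw [Finset.card_erase_of_mem hwW, hW]; rfl)
    suffices ∃ m, (w.owner = none → w.Holds (fun a => if a = w then m else v a)) ∧
        ∀ c, w.owner = some c → v ∘ c ∈ relOf L n M →
          (Θ c).Realize (fun a => if a = w then m else v a) by
      obtain ⟨m, hm1, hm2⟩ := this
      refine ⟨fun a => if a = w then m else v a, fun u hu huo => ?_, fun c hc => ?_⟩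
      · by_cases huw : u = w
        · subst huw
          exact hm1 huo
        · exact (hupd v m u hu huw).2 (hv u (by simpa [huw] using hu) huo)
      · by_cases h1 : w ∈ Set.range c
        · exact hM.realize c (Θ c) (hpos c)
            (fun N _ _ v h h' => hΘ c N v h h' fun u hu huc => (hrange c h1 u hu huc).elim) _ hc
        · rw [hcomp v m c h1] at hc
          by_cases h2 : w.owner = some c
          · exact hm2 c h2 hc
          · have := hvΘ c hc
            simp only [h1, h2, if_false] at this
            exact (hA c M v).1 this m
    rcases ho : w.owner with _ | c
    · obtain ⟨m, hm⟩ := exists_holds_update v w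
      exact ⟨m, fun _ => hm, by simp⟩
    · by_cases hc : v ∘ c ∈ relOf L n M
      · have h1 : w ∉ Set.range c := by
          rintro ⟨i, hi⟩
          exact (w.rank_owner_lt c ho i).ne (by rw [hi])
        have := hvΘ c hc
        simp only [h1, ho, if_false, if_true] at this
        obtain ⟨m, hm⟩ := (hE c M v).1 this
        refine ⟨m, by simp, fun c' hc' _ => ?_⟩
        obtain rfl : c = c' := by simpa using hc'
        exact hm
      · refine ⟨Classical.arbitrary M, by simp, fun c' hc' h' => ?_⟩
        obtain rfl : c = c' := by simpa using hc'
        exact (hc h').elim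

end Witnesses

section Amalgamation

variable {L : FirstOrder.Language.{0, 0}} {n : ℕ} {α : Type}

/-- The formula `R c`. -/
def relFormula (L : FirstOrder.Language.{0, 0}) (c : Fin n → α) : (L.sum (LR n)).Formula α :=
  BoundedFormula.rel (Sum.inr (Rsym n)) fun i => Term.var (Sum.inl (c i))

theorem onlyPos_relFormula (c : Fin n → α) : OnlyPos n (relFormula L c) true :=
  (onlyPos_rel_inr _ _ _).2 rfl

theorem realize_relFormula {M : Type} [(L.sum (LR n)).Structure M] (c : Fin n → α) (v : α → M) :
    (relFormula L c).Realize v ↔ v ∘ c ∈ relOf L n M :=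
  Iff.rfl

theorem realize_relabel_elim {M : Type} [(L.sum (LR n)).Structure M]
    (φ : (L.sum (LR n)).Sentence) (v : α → M) :
    (Formula.relabel Empty.elim φ : (L.sum (LR n)).Formula α).Realize v ↔ φ.Realize M := by
  rw [Formula.realize_relabel, Sentence.Realize, Subsingleton.elim (v ∘ Empty.elim) default]

theorem exists_forall_realize_of_finset {ι : Type} {L : FirstOrder.Language.{0, 0}}
    (g : ι → L.Formula α)
    (h : ∀ s : Finset ι, ∃ (M : Type) (_ : Nonempty M) (_ : L.Structure M)
      (v : α → M), ∀ i ∈ s, (g i).Realize v) :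
    ∃ (M : Type) (_ : Nonempty M) (_ : L.Structure M) (v : α → M), ∀ i, (g i).Realize v := by
  classical
  obtain ⟨M, hM, S, v, hv⟩ := exists_realize_of_finite (Set.range g) fun T₀ hT₀ => by
    rw [← Set.image_univ] at hT₀
    obtain ⟨s, -, rfl⟩ := Finset.subset_set_image_iff.1 hT₀
    obtain ⟨M, hM, S, v, hv⟩ := h s
    refine ⟨M, hM, S, v, fun f hf => ?_⟩
    obtain ⟨i, hi, rfl⟩ := Finset.mem_image.1 hf
    exact hv i hi
  exact ⟨M, hM, S, v, fun i => hv _ ⟨i, rfl⟩⟩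

/-- A positive formula equivalent to a finite disjunction. -/
noncomputable def finsetSup {L : FirstOrder.Language.{0, 0}} {ι : Type} (s : Finset ι)
    (θ : ι → L.Formula α) : L.Formula α :=
  (Formula.iInf fun i : s => (θ i).not).not

theorem realize_finsetSup {L : FirstOrder.Language.{0, 0}} {ι : Type} (s : Finset ι)
    (θ : ι → L.Formula α) {M : Type} [L.Structure M] (v : α → M) :
    (finsetSup s θ).Realize v ↔ ∃ i ∈ s, (θ i).Realize v := by
  simp [finsetSup, Formula.realize_not]

theorem onlyPos_finsetSup {ι : Type} (s : Finset ι) (θ : ι → (L.sum (LR n)).Formula α)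
    (h : ∀ i, OnlyPos n (θ i) true) : OnlyPos n (finsetSup s θ) true :=
  onlyPos_not _ _ (onlyPos_iInf _ _ fun i => onlyPos_not _ _ (h i))

variable {φ : (L.sum (LR n)).Sentence}

theorem Entails.mono {W W' : Set (Witness L n)} (hW : W ⊆ W') {c : Fin n → Witness L n}
    {θ : (L.sum (LR n)).Formula (Witness L n)} (h : Entails φ W c θ) : Entails φ W' c θ :=
  fun N _ _ v hN hc hH => h N v hN hc fun w hw => hH w (hW hw)

theorem exists_spoke {ι : Type} (c : Fin n → Witness L n)
    (θ : ι → (L.sum (LR n)).Formula (Witness L n))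
    (h : ∀ (W : Finset (Witness L n)) (s : Finset ι), ¬ Entails φ W c (finsetSup s θ)) :
    ∃ (N : Type) (_ : Nonempty N) (_ : (L.sum (LR n)).Structure N) (v : Witness L n → N),
      φ.Realize N ∧ v ∘ c ∈ relOf L n N ∧ (∀ w : Witness L n, w.owner = some c → w.Holds v) ∧
        ∀ i, ¬ (θ i).Realize v := by
  classical
  let g : Unit ⊕ {w : Witness L n // w.owner = some c} ⊕ ι →
      (L.sum (LR n)).Formula (Witness L n) :=
    Sum.elim (fun _ => Formula.relabel Empty.elim φ ⊓ relFormula L c)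
      (Sum.elim (fun w => w.1.henkinFormula) fun i => (θ i).not)
  obtain ⟨N, hN, S, v, hv⟩ := exists_forall_realize_of_finset g fun s => by
    have := h (s.toRight.toLeft.map (Function.Embedding.subtype _)) s.toRight.toRight
    simp only [Entails, realize_finsetSup, not_forall] at this
    obtain ⟨N, hN, S, v, hφ, hc, hH, hθ⟩ := this
    refine ⟨N, hN, S, v, ?_⟩
    rintro (_ | w | i) hi
    · exact Formula.realize_inf.2 ⟨(realize_relabel_elim φ v).2 hφ, (realize_relFormula c v).2 hc⟩
    · exact (w.1.realize_henkinFormula v).2 (hH _ (by simpa using ⟨w.2, hi⟩) w.2)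
    · exact fun hi' => hθ ⟨i, by simpa using hi, hi'⟩
  have h0 := Formula.realize_inf.1 (hv (Sum.inl ()))
  exact ⟨N, hN, S, v, (realize_relabel_elim φ v).1 h0.1, (realize_relFormula c v).1 h0.2,
    fun w hw => (w.realize_henkinFormula v).1 (hv (Sum.inr (Sum.inl ⟨w, hw⟩))),
    fun i => hv (Sum.inr (Sum.inr i))⟩

theorem Entails.exists_finset {c : Fin n → Witness L n}
    {θ : (L.sum (LR n)).Formula (Witness L n)} (h : Entails φ Set.univ c θ) :
    ∃ W : Finset (Witness L n), Entails φ W c θ := by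
  by_contra! hW
  obtain ⟨N, _, _, v, hφ, hc, hH, hθ⟩ := exists_spoke (φ := φ) c (fun _ : Unit => θ)
    fun W s hs => hW W fun N _ _ v hφ hc hH => by
      obtain ⟨_, _, h'⟩ := (realize_finsetSup _ _ _).1 (hs N v hφ hc hH)
      exact h'
  exact hθ () (h N v hφ hc fun w _ => hH w)

theorem SatMyopic.exists_hub {M : Type} [Nonempty M] [(L.sum (LR n)).Structure M]
    (hM : SatMyopic φ M) (hφ : ¬ φ.Realize M) :
    ∃ (N : Type) (_ : Nonempty N) (_ : (L.sum (LR n)).Structure N) (v : Witness L n → N),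
      ¬ φ.Realize N ∧ (∀ w : Witness L n, w.owner = none → w.Holds v) ∧
        ∀ c (θ : (L.sum (LR n)).Formula (Witness L n)), OnlyPos n θ true →
          Entails φ Set.univ c θ → v ∘ c ∈ relOf L n N → θ.Realize v := by
  classical
  let g : Unit ⊕ {w : Witness L n // w.owner = none} ⊕
      {p : (Fin n → Witness L n) × (L.sum (LR n)).Formula (Witness L n) //
        OnlyPos n p.2 true ∧ Entails φ Set.univ p.1 p.2} →
      (L.sum (LR n)).Formula (Witness L n) :=
    Sum.elim (fun _ => Formula.not (Formula.relabel Empty.elim φ))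
      (Sum.elim (fun w => w.1.henkinFormula) fun p => (relFormula L p.1.1).imp p.1.2)
  obtain ⟨N, hN, S, v, hv⟩ := exists_forall_realize_of_finset g fun s => by
    choose F hF using fun p : {p : (Fin n → Witness L n) × (L.sum (LR n)).Formula (Witness L n) //
        OnlyPos n p.2 true ∧ Entails φ Set.univ p.1 p.2} => p.2.2.exists_finset
    let Q := s.toRight.toRight
    obtain ⟨v, hv, hΘ⟩ := hM.exists_valuation
      (s.toRight.toLeft.map (Function.Embedding.subtype _) ∪ Q.biUnion F)
      (fun c => Formula.iInf fun p : {p : Q // p.1.1.1 = c} => p.1.1.1.2)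
      (fun c => onlyPos_iInf _ _ fun p => p.1.1.2.1)
      (fun c N _ _ v hN hc hH => by
        rw [Formula.realize_iInf]
        rintro ⟨p, rfl⟩
        refine hF p.1 N v hN hc fun w hw => hH w ?_
        exact Finset.mem_coe.2 (Finset.mem_union_right _ (Finset.mem_biUnion.2 ⟨p.1, p.2, hw⟩)))
    refine ⟨M, inferInstance, inferInstance, v, ?_⟩
    rintro (_ | w | p) hi
    · exact Formula.realize_not.2 fun h => hφ ((realize_relabel_elim φ v).1 h)
    · exact (w.1.realize_henkinFormula v).2 (hv _ (by
        refine Finset.mem_union_left _ ?_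
        simpa using ⟨w.2, hi⟩) w.2)
    · refine Formula.realize_imp.2 fun h => ?_
      have := Formula.realize_iInf.1 (hΘ p.1.1 ((realize_relFormula _ v).1 h))
      exact this ⟨⟨p, by simpa [Q] using hi⟩, rfl⟩
  exact ⟨N, hN, S, v, fun h => Formula.realize_not.1 (hv (Sum.inl ()))
      ((realize_relabel_elim φ v).2 h),
    fun w hw => (w.realize_henkinFormula v).1 (hv (Sum.inr (Sum.inl ⟨w, hw⟩))),
    fun c θ hθ hE hc => Formula.realize_imp.1 (hv (Sum.inr (Sum.inr ⟨(c, θ), hθ, hE⟩)))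
      ((realize_relFormula c v).2 hc)⟩

/-- If positive formulas are preserved from `(N, u)` to `(M, v)`, then `N` is isomorphic to an
expansion of the `L`-reduct of `M` by a subrelation of `R`. -/
theorem exists_satR_of_onlyPos {M N : Type} [(L.sum (LR n)).Structure M]
    [(L.sum (LR n)).Structure N] (v : α → M) (hv : Function.Surjective v) (u : α → N)
    (hu : Function.Surjective u)
    (h : ∀ θ : (L.sum (LR n)).Formula α, OnlyPos n θ true → θ.Realize u → θ.Realize v)
    (hφ : φ.Realize N) :
    ∃ P ⊆ relOf L n M,
      @satR L n M ((LHom.sumInl : L →ᴸ L.sum (LR n)).reduct M) P φ ∧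
        ∀ c : Fin n → α, u ∘ c ∈ relOf L n N → v ∘ c ∈ P := by
  have h_iff (θ : (L.sum (LR n)).Formula α) (h1 : OnlyPos n θ true) (h2 : OnlyPos n θ false) :
      θ.Realize u ↔ θ.Realize v :=
    ⟨h θ h1, fun h3 => by_contra fun h4 => h θ.not (onlyPos_not _ _ h2) h4 h3⟩
  have h_eq (a b : α) : u a = u b ↔ v a = v b := by
    simpa using h_iff (Term.equal (.var a) (.var b)) (onlyPos_equal _ _ _) (onlyPos_equal _ _ _)
  let e : N ≃ M := Equiv.ofBijective (fun x => v (Function.surjInv hu x))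
    ⟨fun x y hxy => by
      have := (h_eq _ _).2 hxy
      rwa [Function.surjInv_eq hu, Function.surjInv_eq hu] at this,
    fun y => by
      obtain ⟨a, rfl⟩ := hv y
      exact ⟨u a, (h_eq _ _).1 (Function.surjInv_eq hu _)⟩⟩
  have he (a : α) : e (u a) = v a := (h_eq _ _).1 (Function.surjInv_eq hu _)
  have he' {k : ℕ} (c : Fin k → α) : e ∘ u ∘ c = v ∘ c := funext fun i => he (c i)
  have hes {k : ℕ} (c : Fin k → α) : e.symm ∘ v ∘ c = u ∘ c :=
    funext fun i => e.symm_apply_eq.2 (he (c i)).symm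
  have hfun {k : ℕ} (f : L.Functions k) (x : Fin k → N) :
      e (Structure.funMap (L := L.sum (LR n)) (Sum.inl f) x) =
        Structure.funMap (L := L.sum (LR n)) (Sum.inl f) (e ∘ x) := by
    choose c hc using fun i => hu (x i)
    obtain rfl : u ∘ c = x := funext hc
    obtain ⟨b, hb⟩ := hu (Structure.funMap (L := L.sum (LR n)) (Sum.inl f) (u ∘ c))
    have := (h_iff (Term.equal
      (Term.func (L := L.sum (LR n)) (Sum.inl f) fun i => .var (c i)) (.var b))
      (onlyPos_equal _ _ _) (onlyPos_equal _ _ _)).1 (Formula.realize_equal.2 hb.symm)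
    rw [he', ← hb, he]
    exact (Formula.realize_equal.1 this).symm
  have hrel {k : ℕ} (f : L.Relations k) (x : Fin k → N) :
      Structure.RelMap (L := L.sum (LR n)) (Sum.inl f) (e ∘ x) ↔
        Structure.RelMap (L := L.sum (LR n)) (Sum.inl f) x := by
    choose c hc using fun i => hu (x i)
    obtain rfl : u ∘ c = x := funext hc
    rw [he']
    exact (h_iff (BoundedFormula.rel (L := L.sum (LR n)) (Sum.inl f)
      fun i => .var (Sum.inl (c i))) (onlyPos_rel_inl _ _ _) (onlyPos_rel_inl _ _ _)).symm
  refine ⟨{x | e.symm ∘ x ∈ relOf L n N}, fun x hx => ?_, ?_, fun c hc => ?_⟩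
  · choose c hc using fun i => hv (x i)
    obtain rfl : v ∘ c = x := funext hc
    change e.symm ∘ v ∘ c ∈ relOf L n N at hx
    rw [hes] at hx
    exact h (relFormula L c) (onlyPos_relFormula c) hx
  · unfold satR
    let S : (L.sum (LR n)).Structure M :=
      @sumStructure L (LR n) M ((LHom.sumInl : L →ᴸ L.sum (LR n)).reduct M)
        (withRel n {x | e.symm ∘ x ∈ relOf L n N})
    let E : @FirstOrder.Language.Equiv (L.sum (LR n)) N M _ S :=
      { e with
        map_fun' := by
          rintro k (f | f) x
          · exact hfun f x
          · exact f.elim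
        map_rel' := by
          rintro k (f | f) x
          · exact hrel f x
          · obtain ⟨hk⟩ := f
            cases hk
            change e.symm ∘ e ∘ x ∈ relOf L _ N ↔ x ∈ relOf L _ N
            rw [← Function.comp_assoc, e.symm_comp_self, Function.id_comp] }
    exact (StrongHomClass.realize_sentence E φ).1 hφ
  · change e.symm ∘ v ∘ c ∈ relOf L n N
    rw [hes]
    exact hc

theorem SatMyopic.realize_of_union_closed {M : Type} [Nonempty M] [(L.sum (LR n)).Structure M]
    (hM : SatMyopic φ M)
    (hU : ∀ (M : Type) [Nonempty M] [L.Structure M]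
        (ι : Type) (P : ι → Set (Fin n → M)),
        (∀ i, satR L n M (P i) φ) → satR L n M (⋃ i, P i) φ) : φ.Realize M := by
  by_contra hφ
  obtain ⟨H, _, _, v', hφ', hH, hE'⟩ := hM.exists_hub hφ
  obtain ⟨H, _, _, v, hv, hvv'⟩ := exists_surjective_realize v' fun k ψ a m hm =>
    ⟨_, hH (Witness.hub k ψ a) rfl m hm⟩
  have hφ : ¬ φ.Realize H := by
    rwa [← realize_relabel_elim φ v, hvv', realize_relabel_elim]
  have hE : ∀ c (θ : (L.sum (LR n)).Formula (Witness L n)), OnlyPos n θ true →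
      Entails φ Set.univ c θ → v ∘ c ∈ relOf L n H → θ.Realize v := by
    intro c θ hθ h hc
    rw [← realize_relFormula, hvv', realize_relFormula] at hc
    exact (hvv' θ).2 (hE' c θ hθ h hc)
  clear hvv' hE' hφ' hH
  have key (c : {c // v ∘ c ∈ relOf L n H}) : ∃ P ⊆ relOf L n H,
      @satR L n H ((LHom.sumInl : L →ᴸ L.sum (LR n)).reduct H) P φ ∧ v ∘ c.1 ∈ P := by
    obtain ⟨c, hc⟩ := c
    obtain ⟨N, _, _, u', hN', hc', hu', hθ⟩ := exists_spoke (φ := φ) c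
      (fun θ : {θ : (L.sum (LR n)).Formula (Witness L n) // OnlyPos n θ true ∧ ¬ θ.Realize v} =>
        θ.1) fun W s hs => by
      obtain ⟨θ, -, hθ⟩ := (realize_finsetSup _ _ _).1
        (hE c _ (onlyPos_finsetSup _ _ fun θ => θ.2.1) (hs.mono (Set.subset_univ _)) hc)
      exact θ.2.2 hθ
    obtain ⟨N, _, _, u, hu, huu'⟩ := exists_surjective_realize u' fun k ψ a m hm =>
      ⟨_, hu' (Witness.spoke c k ψ a) rfl m hm⟩
    have hN : φ.Realize N := by
      rwa [← realize_relabel_elim φ u, huu', realize_relabel_elim]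
    obtain ⟨P, hP, hPφ, hPc⟩ := exists_satR_of_onlyPos v hv u hu
      (fun θ h h' => by_contra fun h'' => hθ ⟨θ, h, h''⟩ ((huu' θ).1 h')) hN
    refine ⟨P, hP, hPφ, hPc c ?_⟩
    rwa [← realize_relFormula, huu', realize_relFormula]
  choose P hP hPφ hPc using key
  have := @hU H _ ((LHom.sumInl : L →ᴸ L.sum (LR n)).reduct H) _ P hPφ
  have hunion : ⋃ c, P c = relOf L n H := by
    refine Set.Subset.antisymm (Set.iUnion_subset hP) fun x hx => ?_
    choose c hc using fun i => hv (x i)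
    obtain rfl : v ∘ c = x := funext hc
    exact Set.mem_iUnion.2 ⟨⟨c, hx⟩, hPc ⟨c, hx⟩⟩
  rw [hunion, satR_relOf] at this
  exact hφ this

theorem exists_myopic_iff
    (hU : ∀ (M : Type) [Nonempty M] [L.Structure M]
        (ι : Type) (P : ι → Set (Fin n → M)),
        (∀ i, satR L n M (P i) φ) → satR L n M (⋃ i, P i) φ) :
    ∃ θ : (L.sum (LR n)).BoundedFormula Empty n, OnlyPos n θ true ∧
      ∀ (M : Type) [Nonempty M] [(L.sum (LR n)).Structure M],
        φ.Realize M ↔ (myopic n θ).Realize M := by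
  classical
  by_contra! hne
  let I := {θ : (L.sum (LR n)).BoundedFormula Empty n // OnlyPos n θ true ∧
    ∀ (N : Type) [Nonempty N] [(L.sum (LR n)).Structure N], φ.Realize N → (myopic n θ).Realize N}
  obtain ⟨M, _, _, v, hv⟩ := exists_forall_realize_of_finset
    (Sum.elim (fun _ : Unit => Formula.not φ) fun θ : I => myopic n θ.1) fun s => by
      have hreal {M : Type} [(L.sum (LR n)).Structure M] :
          (myopic n (BoundedFormula.iInf fun θ : s.toRight => θ.1.1)).Realize M ↔
            ∀ θ ∈ s.toRight, (myopic n θ.1).Realize M := by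
        simp only [realize_myopic, BoundedFormula.realize_iInf]
        exact ⟨fun h θ hθ x hx => h x hx ⟨θ, hθ⟩, fun h x hx θ => h θ.1 θ.2 x hx⟩
      obtain ⟨M, _, _, hM⟩ := hne (BoundedFormula.iInf fun θ : s.toRight => θ.1.1)
        (onlyPos_iInf _ _ fun θ => θ.1.2.1)
      have h1 : φ.Realize M → ∀ θ ∈ s.toRight, (myopic n θ.1).Realize M :=
        fun h θ _ => θ.2.2 M h
      rw [hreal] at hM
      refine ⟨M, inferInstance, inferInstance, default, ?_⟩
      rintro (_ | θ) hi
      · refine Formula.realize_not.2 fun h => ?_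
        have h' : φ.Realize M := h
        tauto
      · have : (myopic n θ.1).Realize M := by
          have := Finset.mem_toRight.2 hi
          by_cases h : φ.Realize M
          · exact h1 h θ this
          · have : ∀ θ ∈ s.toRight, (myopic n θ.1).Realize M := by tauto
            exact this θ (Finset.mem_toRight.2 hi)
        exact this
  rw [Subsingleton.elim v default] at hv
  have hM : SatMyopic φ M := fun θ h h' => hv (Sum.inr ⟨θ, h, h'⟩)
  exact Formula.realize_not.1 (hv (Sum.inl ())) (hM.realize_of_union_closed hU)

end Amalgamation

section Sublanguage

universe u v

variable {L : FirstOrder.Language.{u, v}}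

/-- The language with a countable set `F` of the function symbols of `L` and a countable set `G` of
its relation symbols, moved to the lowest universe. -/
def countableSublanguage (F : Set (Σ k, L.Functions k)) (G : Set (Σ k, L.Relations k)) [Countable F]
    [Countable G] : FirstOrder.Language.{0, 0} where
  Functions k := {x : Shrink.{0} F // ((equivShrink.{0} F).symm x).1.1 = k}
  Relations k := {x : Shrink.{0} G // ((equivShrink.{0} G).symm x).1.1 = k}

variable (F : Set (Σ k, L.Functions k)) (G : Set (Σ k, L.Relations k)) [Countable F]
  [Countable G]

/-- The inclusion of a countable sublanguage. -/
noncomputable def countableInclusion : countableSublanguage F G →ᴸ L where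
  onFunction _ x := x.2 ▸ ((equivShrink.{0} F).symm x.1).1.2
  onRelation _ x := x.2 ▸ ((equivShrink.{0} G).symm x.1).1.2

theorem sigma_onFunction {k : ℕ} (x : (countableSublanguage F G).Functions k) :
    (⟨k, (countableInclusion F G).onFunction x⟩ : Σ k, L.Functions k) =
      ((equivShrink.{0} F).symm x.1).1 := by
  obtain ⟨x, rfl⟩ := x
  rfl

theorem sigma_onRelation {k : ℕ} (x : (countableSublanguage F G).Relations k) :
    (⟨k, (countableInclusion F G).onRelation x⟩ : Σ k, L.Relations k) =
      ((equivShrink.{0} G).symm x.1).1 := by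
  obtain ⟨x, rfl⟩ := x
  rfl

theorem exists_onFunction {k : ℕ} (f : L.Functions k) (hf : ⟨k, f⟩ ∈ F) :
    ∃ x, (countableInclusion F G).onFunction x = f := by
  let x : (countableSublanguage F G).Functions k := ⟨equivShrink.{0} F ⟨_, hf⟩, by simp⟩
  have := sigma_onFunction F G x
  exact ⟨x, by simpa [x] using this⟩

theorem exists_onRelation {k : ℕ} (f : L.Relations k) (hf : ⟨k, f⟩ ∈ G) :
    ∃ x, (countableInclusion F G).onRelation x = f := by
  let x : (countableSublanguage F G).Relations k := ⟨equivShrink.{0} G ⟨_, hf⟩, by simp⟩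
  have := sigma_onRelation F G x
  exact ⟨x, by simpa [x] using this⟩

theorem injective_countableInclusion : (countableInclusion F G).Injective where
  onFunction {k} x y hxy := by
    have := (sigma_onFunction F G x).symm.trans
      ((congrArg (Sigma.mk k) hxy).trans (sigma_onFunction F G y))
    exact Subtype.ext ((equivShrink.{0} F).symm.injective (Subtype.ext this))
  onRelation {k} x y hxy := by
    have := (sigma_onRelation F G x).symm.trans
      ((congrArg (Sigma.mk k) hxy).trans (sigma_onRelation F G y))
    exact Subtype.ext ((equivShrink.{0} G).symm.injective (Subtype.ext this))

variable (n : ℕ)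

/-- The inclusion of a countable sublanguage, extended by `R`. -/
noncomputable abbrev countableInclusionSum :
    (countableSublanguage F G).sum (LR n) →ᴸ L.sum (LR n) :=
  (countableInclusion F G).sumMap (LHom.id (LR n))

variable {F G n}

theorem exists_onTerm {α : Type} (t : (L.sum (LR n)).Term α) :
    ∃ F₀ : Set (Σ k, L.Functions k), F₀.Countable ∧
      ∀ (F : Set (Σ k, L.Functions k)) (G : Set (Σ k, L.Relations k)) [Countable F] [Countable G],
        F₀ ⊆ F → ∃ s, (countableInclusionSum F G n).onTerm s = t := by
  induction t with
  | var a => exact ⟨∅, Set.countable_empty, fun F G _ _ _ => ⟨.var a, rfl⟩⟩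
  | @func l f ts ih =>
    choose F₀ hF₀ h using ih
    rcases f with f | f
    · refine ⟨insert ⟨l, f⟩ (⋃ i, F₀ i), (Set.countable_iUnion hF₀).insert _,
        fun F G _ _ hF => ?_⟩
      obtain ⟨x, rfl⟩ := exists_onFunction F G f (hF (Set.mem_insert _ _))
      choose s hs using fun i => h i F G
        ((Set.subset_iUnion F₀ i).trans ((Set.subset_insert _ _).trans hF))
      exact ⟨.func (Sum.inl x) s, congrArg (Term.func _) (funext hs)⟩
    · exact f.elim

theorem exists_onBoundedFormula {α : Type} {k : ℕ} (φ : (L.sum (LR n)).BoundedFormula α k) :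
    ∃ (F₀ : Set (Σ k, L.Functions k)) (G₀ : Set (Σ k, L.Relations k)), F₀.Countable ∧
      G₀.Countable ∧
      ∀ (F : Set (Σ k, L.Functions k)) (G : Set (Σ k, L.Relations k)) [Countable F] [Countable G],
        F₀ ⊆ F → G₀ ⊆ G → ∃ ψ, (countableInclusionSum F G n).onBoundedFormula ψ = φ := by
  induction φ with
  | falsum =>
    exact ⟨∅, ∅, Set.countable_empty, Set.countable_empty, fun F G _ _ _ _ => ⟨.falsum, rfl⟩⟩
  | equal t₁ t₂ =>
    obtain ⟨F₁, hF₁, h₁⟩ := exists_onTerm t₁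
    obtain ⟨F₂, hF₂, h₂⟩ := exists_onTerm t₂
    refine ⟨F₁ ∪ F₂, ∅, hF₁.union hF₂, Set.countable_empty, fun F G _ _ hF _ => ?_⟩
    obtain ⟨s₁, rfl⟩ := h₁ F G (Set.subset_union_left.trans hF)
    obtain ⟨s₂, rfl⟩ := h₂ F G (Set.subset_union_right.trans hF)
    exact ⟨.equal s₁ s₂, rfl⟩
  | @rel _ l f ts =>
    choose F₀ hF₀ h using fun i => exists_onTerm (ts i)
    rcases f with f | f
    · refine ⟨⋃ i, F₀ i, {⟨l, f⟩}, Set.countable_iUnion hF₀, Set.countable_singleton _,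
        fun F G _ _ hF hG => ?_⟩
      obtain ⟨x, rfl⟩ := exists_onRelation F G f (hG rfl)
      choose s hs using fun i => h i F G ((Set.subset_iUnion F₀ i).trans hF)
      exact ⟨.rel (Sum.inl x) s, congrArg (BoundedFormula.rel _) (funext hs)⟩
    · refine ⟨⋃ i, F₀ i, ∅, Set.countable_iUnion hF₀, Set.countable_empty,
        fun F G _ _ hF _ => ?_⟩
      choose s hs using fun i => h i F G ((Set.subset_iUnion F₀ i).trans hF)
      exact ⟨.rel (Sum.inr f) s, congrArg (BoundedFormula.rel _) (funext hs)⟩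
  | imp φ ψ ihφ ihψ =>
    obtain ⟨F₁, G₁, hF₁, hG₁, h₁⟩ := ihφ
    obtain ⟨F₂, G₂, hF₂, hG₂, h₂⟩ := ihψ
    refine ⟨F₁ ∪ F₂, G₁ ∪ G₂, hF₁.union hF₂, hG₁.union hG₂, fun F G _ _ hF hG => ?_⟩
    obtain ⟨s₁, rfl⟩ := h₁ F G (Set.subset_union_left.trans hF) (Set.subset_union_left.trans hG)
    obtain ⟨s₂, rfl⟩ := h₂ F G (Set.subset_union_right.trans hF) (Set.subset_union_right.trans hG)
    exact ⟨.imp s₁ s₂, rfl⟩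
  | all φ ih =>
    obtain ⟨F₁, G₁, hF₁, hG₁, h₁⟩ := ih
    refine ⟨F₁, G₁, hF₁, hG₁, fun F G _ _ hF hG => ?_⟩
    obtain ⟨s, rfl⟩ := h₁ F G hF hG
    exact ⟨.all s, rfl⟩

variable {L₀ : FirstOrder.Language.{0, 0}} (ι : L₀ →ᴸ L)

theorem onlyPos_onBoundedFormula {α : Type} {k : ℕ} (φ : (L₀.sum (LR n)).BoundedFormula α k)
    (b : Bool) (hφ : OnlyPos n φ b) :
    OnlyPos n ((ι.sumMap (LHom.id (LR n))).onBoundedFormula φ) b := by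
  induction φ generalizing b with
  | falsum => exact onlyPos_falsum _
  | equal => exact onlyPos_equal _ _ _
  | rel f ts =>
    rcases f with f | f
    · exact onlyPos_rel_inl _ _ _
    · exact (onlyPos_rel_inr _ _ _).2 ((onlyPos_rel_inr _ _ _).1 hφ)
  | imp φ ψ ihφ ihψ =>
    rw [onlyPos_imp] at hφ
    exact (onlyPos_imp _ _ _).2 ⟨ihφ _ hφ.1, ihψ _ hφ.2⟩
  | all φ ih => exact (onlyPos_all _ _).2 (ih _ ((onlyPos_all _ _).1 hφ))

variable {M : Type} [L₀.Structure M] [L.Structure M] [ι.IsExpansionOn M]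

theorem satR_onSentence (φ : (L₀.sum (LR n)).Sentence) (P : Set (Fin n → M)) :
    satR L n M P ((ι.sumMap (LHom.id (LR n))).onSentence φ) ↔ satR L₀ n M P φ := by
  let : (LR n).Structure M := withRel n P
  exact LHom.realize_onSentence M (ι.sumMap (LHom.id (LR n))) φ

theorem satR_myopic_onBoundedFormula (θ : (L₀.sum (LR n)).BoundedFormula Empty n)
    (P : Set (Fin n → M)) :
    satR L n M P (myopic n ((ι.sumMap (LHom.id (LR n))).onBoundedFormula θ)) ↔
      satR L₀ n M P (myopic n θ) := by
  let : (LR n).Structure M := withRel n P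
  refine (realize_myopic _).trans (Iff.trans ?_ (realize_myopic _).symm)
  exact forall₂_congr fun x _ =>
    LHom.realize_onBoundedFormula (ι.sumMap (LHom.id (LR n))) θ

end Sublanguage

end TeamSem


open TeamSem in
/-- Theorem `FOunion`, preservation part: let `φ(R)` be a first-order
sentence over `Σ ∪ {R}` (`R` an `n`-ary relation symbol) defining a union-closed property
of `R`: for every `Σ`-structure `M` and every family `(P_i)_{i ∈ ι}` of `n`-ary relations
on `M` with `(M, P_i) ⊨ φ` for all `i`, also `(M, ⋃ i, P_i) ⊨ φ` (in particular, for `ι`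
empty, `(M, ∅) ⊨ φ`). Then `φ(R)` is logically equivalent to a myopic sentence
`∀x̄ (Rx̄ → θ(R, x̄))`, `θ` first-order with `R` occurring only positively. -/
theorem union_closed_iff_myopic {L : Language} (n : ℕ) (φ : (L.sum (LR n)).Sentence)
    (hU : ∀ (M : Type) [Nonempty M] [L.Structure M]
        (ι : Type) (P : ι → Set (Fin n → M)),
        (∀ i, satR L n M (P i) φ) → satR L n M (⋃ i, P i) φ) :
    ∃ θ : (L.sum (LR n)).BoundedFormula Empty n, OnlyPos n θ true ∧
      ∀ (M : Type) [Nonempty M] [L.Structure M] (P : Set (Fin n → M)),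
        satR L n M P φ ↔ satR L n M P (myopic n θ) := by
  obtain ⟨F, G, hF, hG, h⟩ := exists_onBoundedFormula φ
  have := hF.to_subtype
  have := hG.to_subtype
  obtain ⟨φ₀, rfl⟩ := h F G subset_rfl subset_rfl
  let ι := countableInclusion F G
  obtain ⟨θ, hθ, hφθ⟩ := exists_myopic_iff (φ := φ₀) fun M _ _ I P hP => by
    classical
    let : Inhabited M := Classical.inhabited_of_nonempty inferInstance
    let : L.Structure M := ι.defaultExpansion M
    have : ι.IsExpansionOn M := (injective_countableInclusion F G).isExpansionOn_default M
    exact (satR_onSentence ι φ₀ _).1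
      (hU M I P fun i => (satR_onSentence ι φ₀ _).2 (hP i))
  refine ⟨_, onlyPos_onBoundedFormula ι θ true hθ, fun M _ _ P => ?_⟩
  let : (countableSublanguage F G).Structure M := ι.reduct M
  have : ι.IsExpansionOn M := LHom.isExpansionOn_reduct _ _
  let : (LR n).Structure M := withRel n P
  exact (satR_onSentence ι φ₀ P).trans
    ((hφθ M).trans (satR_myopic_onBoundedFormula ι θ P).symm)
end
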